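/- arXiv:2410.07556 — 2 statements merged into one kernel-verified Lean document; each statement's English description precedes it below -/
import Mathlib

section
/- Let n ≥ 7 be an integer and let A_n be the alternating group on n letters. Then λ·S(Aut(A_n)) < b(A_n)^μ, where λ = 24^{1/3} and μ = 3·log_{504}(168). -/
/-- `b G`: the largest degree of a complex irreducible character of `G`. -/
noncomputable def maxIrrCharDegree (G : Type) [Group G] : ℕ :=
  sSup {d | ∃ V : FDRep ℂ G, CategoryTheory.Simple V ∧ Module.finrank ℂ V = d}

/-- `S G`: the largest order of a solvable subgroup of `G`. -/
noncomputable def maxSolvableOrder (G : Type*) [Group G] : ℕ :=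
  sSup {n | ∃ H : Subgroup G, IsSolvable H ∧ Nat.card H = n}

section CharacterDegrees

open CategoryTheory

variable {G : Type} [Group G] [Finite G]

/-- A representation whose commutant consists of scalars is simple. -/
theorem FDRep.simple_of_commutant {V : Type} [AddCommGroup V] [Module ℂ V]
    [Module.Finite ℂ V] [Nontrivial V] (ρ : Representation ℂ G V)
    (h : ∀ T : V →ₗ[ℂ] V, (∀ g, T ∘ₗ ρ g = ρ g ∘ₗ T) → ∃ c : ℂ, T = c • LinearMap.id) :
    Simple (FDRep.of ρ) := by
  rw [FDRep.simple_iff_end_is_rank_one]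
  rw [← (FDRep.forget₂HomLinearEquiv (FDRep.of ρ) (FDRep.of ρ)).finrank_eq]
  refine (finrank_eq_one_iff_of_nonzero' (𝟙 _) ?_).2 ?_
  · intro h0
    obtain ⟨v, hv⟩ := exists_ne (0 : V)
    apply hv
    have := congrArg (fun f => f.hom.toLinearMap v) h0
    exact this
  · intro w
    obtain ⟨c, hc⟩ := h w.hom.toLinearMap (fun g => w.hom.isIntertwining' g)
    refine ⟨c, ?_⟩
    ext x
    exact (congrArg (fun f : V →ₗ[ℂ] V => f x) hc).symm

/-- Schur's lemma for the commutant of a simple representation. -/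
theorem FDRep.commutant_of_simple (V : FDRep ℂ G) [Simple V] (T : V →ₗ[ℂ] V)
    (hT : ∀ g, T ∘ₗ V.ρ g = V.ρ g ∘ₗ T) : ∃ c : ℂ, T = c • LinearMap.id := by
  have h1 := (FDRep.simple_iff_end_is_rank_one V).1 inferInstance
  rw [← (FDRep.forget₂HomLinearEquiv V V).finrank_eq] at h1
  have hne : (𝟙 ((forget₂ (FDRep ℂ G) (Rep ℂ G)).obj V)) ≠ 0 := by
    intro h0
    have h2 : 𝟙 V = 0 := by
      apply (forget₂ (FDRep ℂ G) (Rep ℂ G)).map_injective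
      simpa using h0
    exact Simple.not_isZero V ((Limits.IsZero.iff_id_eq_zero V).2 h2)
  obtain ⟨c, hc⟩ := (finrank_eq_one_iff_of_nonzero' _ hne).1 h1 (Rep.ofHom ⟨T, hT⟩)
  refine ⟨c, ?_⟩
  ext x
  exact (congrArg (fun f => f.hom.toLinearMap x) hc).symm

theorem FDRep.finrank_le_card_of_simple (V : FDRep ℂ G) [Simple V] :
    Module.finrank ℂ V ≤ Nat.card G := by
  have := Fintype.ofFinite G
  by_cases hV : Subsingleton V
  · simp [Module.finrank_zero_of_subsingleton]
  rw [not_subsingleton_iff_nontrivial] at hV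
  obtain ⟨v, hv⟩ := exists_ne (0 : V)
  obtain ⟨φ, hφ⟩ : ∃ φ : Module.Dual ℂ V, φ v ≠ 0 := by
    by_contra! hcon
    exact hv ((Module.forall_dual_apply_eq_zero_iff ℂ v).1 hcon)
  let T : V →ₗ[ℂ] V := ∑ g : G, V.ρ g ∘ₗ (φ.smulRight v) ∘ₗ V.ρ g⁻¹
  have hT : ∀ g, T ∘ₗ V.ρ g = V.ρ g ∘ₗ T := by
    intro g
    ext x
    simp only [T, LinearMap.sum_apply, LinearMap.comp_apply, map_sum]
    refine Fintype.sum_equiv (Equiv.mulLeft g⁻¹) _ _ fun h => ?_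
    simp only [Equiv.coe_mulLeft, ← Module.End.mul_apply, ← map_mul]
    simp only [Module.End.mul_apply, LinearMap.smulRight_apply, map_smul]
    simp only [← Module.End.mul_apply, ← map_mul]
    simp
  obtain ⟨c, hc⟩ := FDRep.commutant_of_simple V T hT
  have hc0 : c ≠ 0 := by
    rintro rfl
    have htr : LinearMap.trace ℂ V T = Nat.card G * φ v := by
      simp only [T, map_sum]
      rw [Finset.sum_congr rfl (g := fun _ => φ v)]
      · simp
      · intro g _
        rw [LinearMap.trace_comp_comm', LinearMap.comp_assoc]
        have : V.ρ g⁻¹ ∘ₗ V.ρ g = LinearMap.id := by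
          rw [← Module.End.mul_eq_comp, ← map_mul]; simp; rfl
        rw [this, LinearMap.comp_id]
        simp
    rw [hc] at htr
    simp [hφ] at htr
  have hspan : Submodule.span ℂ (Set.range fun g => V.ρ g v) = ⊤ := by
    rw [eq_top_iff]
    intro w _
    have hw : c • w = ∑ g : G, φ (V.ρ g⁻¹ w) • V.ρ g v := by
      have := congrArg (fun f : V →ₗ[ℂ] V => f w) hc
      simp only [T, LinearMap.sum_apply, LinearMap.comp_apply, LinearMap.smulRight_apply,
        map_smul, LinearMap.smul_apply, LinearMap.id_apply] at this
      exact this.symm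
    have : w = c⁻¹ • ∑ g : G, φ (V.ρ g⁻¹ w) • V.ρ g v := by
      rw [← hw, inv_smul_smul₀ hc0]
    rw [this]
    exact Submodule.smul_mem _ _ (Submodule.sum_mem _ fun g _ =>
      Submodule.smul_mem _ _ (Submodule.subset_span ⟨g, rfl⟩))
  have := finrank_range_le_card (R := ℂ) (fun g => V.ρ g v)
  rw [Set.finrank, hspan, finrank_top] at this
  rwa [Nat.card_eq_fintype_card]

theorem le_maxIrrCharDegree (V : FDRep ℂ G) (hV : Simple V) :
    Module.finrank ℂ V ≤ maxIrrCharDegree G := by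
  refine le_csSup ⟨Nat.card G, ?_⟩ ⟨V, hV, rfl⟩
  rintro _ ⟨W, hW, rfl⟩
  exact FDRep.finrank_le_card_of_simple W

/-- The number of matrix blocks of a complex group algebra is at most the class number. -/
theorem card_blocks_le_card_conjClasses {r : ℕ} {d : Fin r → ℕ} [∀ i, NeZero (d i)]
    (e : MonoidAlgebra ℂ G ≃ₐ[ℂ] Π i, Matrix (Fin (d i)) (Fin (d i)) ℂ) :
    r ≤ Nat.card (ConjClasses G) := by
  have : Fintype (ConjClasses G) := Fintype.ofFinite _
  let z : (Fin r → ℂ) →ₗ[ℂ] MonoidAlgebra ℂ G :=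
    e.symm.toLinearMap ∘ₗ LinearMap.pi fun i =>
      (LinearMap.toSpanSingleton ℂ _ (1 : Matrix (Fin (d i)) (Fin (d i)) ℂ)) ∘ₗ LinearMap.proj i
  have hz : ∀ c, e (z c) = fun i => c i • 1 := by
    intro c; simp only [z, LinearMap.comp_apply, AlgEquiv.toLinearMap_apply,
      AlgEquiv.apply_symm_apply]; rfl
  have hcomm : ∀ c (x : MonoidAlgebra ℂ G), z c * x = x * z c := by
    intro c x
    apply e.injective
    rw [map_mul, map_mul, hz]
    ext1 i
    simp
  have hconj : ∀ c (g h : G), IsConj g h → (z c).coeff g = (z c).coeff h := by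
    intro c g h hgh
    obtain ⟨k, hk⟩ := isConj_iff.1 hgh
    have := congrArg (fun f : MonoidAlgebra ℂ G => f.coeff (k * g))
      (hcomm c (MonoidAlgebra.single k 1))
    simp only [MonoidAlgebra.coeff_mul_single_apply, MonoidAlgebra.coeff_single_mul_apply] at this
    rw [← hk]
    simpa using this.symm
  let F : (Fin r → ℂ) →ₗ[ℂ] (ConjClasses G → ℂ) :=
    LinearMap.pi fun C => (Finsupp.lapply C.out : (G →₀ ℂ) →ₗ[ℂ] ℂ) ∘ₗ
      (MonoidAlgebra.coeffLinearEquiv ℂ).toLinearMap ∘ₗ z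
  have hF : ∀ c C, F c C = (z c).coeff C.out := fun c C => rfl
  have hinj : Function.Injective F := by
    rw [← LinearMap.ker_eq_bot, LinearMap.ker_eq_bot']
    intro c hc
    have h0 : z c = 0 := by
      ext g
      rw [hconj c g (ConjClasses.mk g).out, ← hF, hc]
      · rfl
      · exact ConjClasses.mk_eq_mk_iff_isConj.1 (Quotient.out_eq (ConjClasses.mk g)).symm
    have h1 := hz c
    rw [h0, map_zero] at h1
    ext i
    have h2 := congrFun (congrFun (congrFun h1 i) 0) 0
    simpa using h2.symm
  have := LinearMap.finrank_le_finrank_of_injective hinj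
  simpa [Nat.card_eq_fintype_card] using this

theorem card_le_card_conjClasses_mul_maxIrrCharDegree_sq :
    Nat.card G ≤ Nat.card (ConjClasses G) * maxIrrCharDegree G ^ 2 := by
  have := Fintype.ofFinite G
  obtain ⟨r, d, hd, ⟨e⟩⟩ :=
    IsSemisimpleRing.exists_algEquiv_pi_matrix_of_isAlgClosed ℂ (MonoidAlgebra ℂ G)
  have hdeg : ∀ i, d i ≤ maxIrrCharDegree G := by
    intro i
    let π : MonoidAlgebra ℂ G →ₐ[ℂ] ((Fin (d i) → ℂ) →ₗ[ℂ] (Fin (d i) → ℂ)) :=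
      (Matrix.toLinAlgEquiv'.toAlgHom.comp (Pi.evalAlgHom ℂ _ i)).comp e.toAlgHom
    have hπ : Function.Surjective π :=
      (Matrix.toLinAlgEquiv'.surjective.comp (Function.surjective_eval i)).comp e.surjective
    let ρ : Representation ℂ G (Fin (d i) → ℂ) := π.toMonoidHom.comp (MonoidAlgebra.of ℂ G)
    have hs : Simple (FDRep.of ρ) := by
      apply FDRep.simple_of_commutant
      intro T hT
      have hall : ∀ x, T ∘ₗ π x = π x ∘ₗ T := by
        intro x
        induction x using MonoidAlgebra.induction_on with
        | of g => exact hT g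
        | add a b ha hb => rw [map_add, LinearMap.comp_add, LinearMap.add_comp, ha, hb]
        | smul c a ha => rw [map_smul, LinearMap.comp_smul, LinearMap.smul_comp, ha]
      have hcen : T ∈ Subalgebra.center ℂ (Module.End ℂ (Fin (d i) → ℂ)) := by
        rw [Subalgebra.mem_center_iff]
        intro S
        obtain ⟨x, rfl⟩ := hπ S
        exact (hall x).symm
      obtain ⟨c, _, hc⟩ := Module.End.mem_subalgebraCenter_iff.1 hcen
      exact ⟨c, by rw [hc]; rfl⟩
    have := le_maxIrrCharDegree _ hs
    refine le_trans (le_of_eq ?_) this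
    exact (Module.finrank_fin_fun ℂ).symm
  have hdim : Nat.card G = ∑ i, d i ^ 2 := by
    have h := e.toLinearEquiv.finrank_eq
    rw [Module.finrank_pi_fintype] at h
    have h3 : Module.finrank ℂ (MonoidAlgebra ℂ G) = Nat.card G := by
      rw [(MonoidAlgebra.coeffLinearEquiv ℂ).finrank_eq, Nat.card_eq_fintype_card]
      exact Module.finrank_finsupp_self ℂ
    rw [h3] at h
    rw [h]
    refine Finset.sum_congr rfl fun i _ => ?_
    simp [Module.finrank_matrix, sq]
  calc Nat.card G = ∑ i, d i ^ 2 := hdim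
    _ ≤ ∑ _i : Fin r, maxIrrCharDegree G ^ 2 :=
        Finset.sum_le_sum fun i _ => Nat.pow_le_pow_left (hdeg i) 2
    _ = r * maxIrrCharDegree G ^ 2 := by simp
    _ ≤ _ := Nat.mul_le_mul_right _ (card_blocks_le_card_conjClasses e)

end CharacterDegrees

section PartitionCount

/-- The multisets of positive integers at most `m` with sum `n`. -/
def boundedParts : ℕ → ℕ → List (Multiset ℕ)
  | 0, n => if n = 0 then [0] else []
  | m + 1, n => (List.range (n / (m + 1) + 1)).flatMap fun j =>
      (boundedParts m (n - j * (m + 1))).map (Multiset.replicate j (m + 1) + ·)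

theorem mem_boundedParts (m : ℕ) : ∀ (n : ℕ) (s : Multiset ℕ),
    (∀ i ∈ s, 0 < i ∧ i ≤ m) → s.sum = n → s ∈ boundedParts m n := by
  induction m with
  | zero =>
    intro n s hs hn
    have : s = 0 := Multiset.eq_zero_of_forall_notMem fun i hi => by have := hs i hi; omega
    subst this
    simp_all [boundedParts]
  | succ m ih =>
    intro n s hs hn
    have hsplit : Multiset.replicate (s.count (m + 1)) (m + 1) + s.filter (m + 1 ≠ ·) = s := by
      rw [← Multiset.filter_eq, Multiset.filter_add_not]
    have hsum : s.count (m + 1) * (m + 1) + (s.filter (m + 1 ≠ ·)).sum = n := by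
      rw [← hn]
      conv_rhs => rw [← hsplit]
      simp
    simp only [boundedParts, List.mem_flatMap, List.mem_range, List.mem_map]
    refine ⟨s.count (m + 1), ?_, s.filter (m + 1 ≠ ·), ih _ _ ?_ (by omega), hsplit⟩
    · rw [Nat.lt_succ_iff, Nat.le_div_iff_mul_le (by omega)]
      omega
    · intro i hi
      rw [Multiset.mem_filter] at hi
      have := hs i hi.1
      omega

theorem card_filter_partition_le (n : ℕ) (P : Multiset ℕ → Prop) [DecidablePred P] :
    (Finset.univ.filter fun p : n.Partition => P p.parts).card ≤
      ((boundedParts n n).filter P).length := by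
  classical
  rw [← Finset.card_image_of_injective _ (f := Nat.Partition.parts)
    (fun _ _ h => Nat.Partition.ext h)]
  refine le_trans (Finset.card_le_card ?_) (List.toFinset_card_le _)
  intro s hs
  simp only [Finset.mem_image, Finset.mem_filter, Finset.mem_univ, true_and] at hs
  obtain ⟨p, hp, rfl⟩ := hs
  simp only [List.mem_toFinset, List.mem_filter, hp, decide_true, and_true]
  refine mem_boundedParts n n _ (fun i hi => ⟨p.parts_pos hi, ?_⟩) p.parts_sum
  exact p.parts_sum ▸ Multiset.le_sum_of_mem hi

theorem card_partition_le_two_pow (n : ℕ) : Fintype.card n.Partition ≤ 2 ^ (n - 1) := by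
  rw [← composition_card]
  exact Fintype.card_le_of_surjective _ Nat.Partition.ofComposition_surj

end PartitionCount

section ConjugacyClasses

open Equiv.Perm

theorem even_add_card_parts_of_mem_alternatingGroup {α : Type*} [Fintype α] [DecidableEq α]
    {σ : Equiv.Perm α} (hσ : σ ∈ alternatingGroup α) :
    Even (Fintype.card α + σ.partition.parts.card) := by
  rw [mem_alternatingGroup, sign_of_cycleType] at hσ
  have h1 : Even (σ.cycleType.sum + σ.cycleType.card) := by
    by_contra hodd
    rw [Nat.not_even_iff_odd] at hodd
    rw [hodd.neg_one_pow] at hσ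
    exact absurd hσ (by decide)
  have h2 := σ.support.card_le_univ
  rw [parts_partition, Multiset.card_add, Multiset.card_replicate]
  rw [sum_cycleType] at h1
  rw [Nat.even_iff] at *
  omega

/-- Among any three even permutations with the same cycle type, two are conjugate
by an even permutation. -/
theorem isConj_of_partition_eq {α : Type*} [Fintype α] [DecidableEq α]
    (x y z : alternatingGroup α)
    (hxy : (x : Equiv.Perm α).partition = (y : Equiv.Perm α).partition)
    (hxz : (x : Equiv.Perm α).partition = (z : Equiv.Perm α).partition) :
    IsConj x y ∨ IsConj x z ∨ IsConj y z := by
  rw [← partition_eq_of_isConj, isConj_iff] at hxy hxz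
  obtain ⟨σ, hσ⟩ := hxy
  obtain ⟨τ, hτ⟩ := hxz
  rcases Int.units_eq_one_or (sign σ) with h | h
  · exact Or.inl (isConj_iff.2 ⟨⟨σ, h⟩, Subtype.ext hσ⟩)
  rcases Int.units_eq_one_or (sign τ) with h' | h'
  · exact Or.inr (Or.inl (isConj_iff.2 ⟨⟨τ, h'⟩, Subtype.ext hτ⟩))
  · refine Or.inr (Or.inr (isConj_iff.2 ⟨⟨τ * σ⁻¹, ?_⟩, Subtype.ext ?_⟩))
    · rw [mem_alternatingGroup]; simp [h, h']
    · change τ * σ⁻¹ * (y : Equiv.Perm α) * (τ * σ⁻¹)⁻¹ = z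
      rw [← hσ, ← hτ]
      group

theorem card_conjClasses_alternatingGroup_le (α : Type*) [Fintype α] [DecidableEq α] :
    Nat.card (ConjClasses (alternatingGroup α)) ≤
      2 * (Finset.univ.filter fun p : (Fintype.card α).Partition =>
        Even (Fintype.card α + p.parts.card)).card := by
  classical
  have : Fintype (ConjClasses (alternatingGroup α)) := Fintype.ofFinite _
  let f : ConjClasses (alternatingGroup α) → (Fintype.card α).Partition :=
    fun C => (C.out : Equiv.Perm α).partition
  rw [Nat.card_eq_fintype_card, ← Finset.card_univ]
  refine (Finset.card_le_mul_card_image (f := f) Finset.univ 2 ?_).trans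
    (Nat.mul_le_mul_left 2 (Finset.card_le_card ?_))
  · intro p _
    by_contra! hcon
    obtain ⟨a, b, c, ha, hb, hc, hab, hac, hbc⟩ := Finset.two_lt_card_iff.1 hcon
    simp only [Finset.mem_filter, Finset.mem_univ, true_and, f] at ha hb hc
    have key : ∀ x y : ConjClasses (alternatingGroup α), IsConj x.out y.out → x = y := by
      intro x y h
      have := ConjClasses.mk_eq_mk_iff_isConj.2 h
      rwa [show ConjClasses.mk x.out = x from Quotient.out_eq x,
        show ConjClasses.mk y.out = y from Quotient.out_eq y] at this
    rcases isConj_of_partition_eq a.out b.out c.out (ha.trans hb.symm) (ha.trans hc.symm)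
      with h | h | h
    · exact hab (key _ _ h)
    · exact hac (key _ _ h)
    · exact hbc (key _ _ h)
  · intro p hp
    obtain ⟨C, -, rfl⟩ := Finset.mem_image.1 hp
    exact Finset.mem_filter.2 ⟨Finset.mem_univ _,
      even_add_card_parts_of_mem_alternatingGroup C.out.2⟩

end ConjugacyClasses

section PrimitiveSolvable

open MulAction

/-- A nontrivial finite solvable group has a nontrivial normal elementary abelian subgroup. -/
theorem exists_normal_elementary_abelian (G : Type*) [Group G] [Finite G] [Nontrivial G]
    [Group.IsSolvable G] :
    ∃ (p : ℕ) (N : Subgroup G), p.Prime ∧ N.Normal ∧ N ≠ ⊥ ∧ (∀ a ∈ N, ∀ b ∈ N, a * b = b * a) ∧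
      ∀ a ∈ N, a ^ p = 1 := by
  classical
  have hex : ∃ m, derivedSeries G m = ⊥ := Group.IsSolvable.solvable
  obtain ⟨m, hm⟩ : ∃ m, Nat.find hex = m + 1 := by
    refine Nat.exists_eq_succ_of_ne_zero fun h0 => ?_
    have := Nat.find_spec hex
    rw [h0, derivedSeries_zero] at this
    exact top_ne_bot this
  set A := derivedSeries G m with hA
  have hAbot : A ≠ ⊥ := Nat.find_min hex (by omega)
  have hAnormal : A.Normal := derivedSeries_normal G m
  have hcomm : ∀ a ∈ A, ∀ b ∈ A, a * b = b * a := by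
    have h := Nat.find_spec hex
    rw [hm, derivedSeries_succ, Subgroup.commutator_eq_bot_iff_le_centralizer] at h
    intro a ha b hb
    exact (Subgroup.mem_centralizer_iff.1 (h ha) b hb).symm
  have hcard : Nat.card A ≠ 1 := fun h => hAbot (Subgroup.card_eq_one.1 h)
  obtain ⟨p, hp, hpA⟩ := Nat.exists_prime_and_dvd hcard
  have := Fact.mk hp
  obtain ⟨x, hx⟩ := exists_prime_orderOf_dvd_card' p hpA
  let N : Subgroup G :=
    { carrier := {a | a ∈ A ∧ a ^ p = 1}
      one_mem' := ⟨A.one_mem, one_pow p⟩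
      mul_mem' := fun {a b} ha hb => ⟨A.mul_mem ha.1 hb.1, by
        rw [(show Commute a b from hcomm a ha.1 b hb.1).mul_pow, ha.2, hb.2, one_mul]⟩
      inv_mem' := fun {a} ha => ⟨A.inv_mem ha.1, by rw [inv_pow, ha.2, inv_one]⟩ }
  refine ⟨p, N, hp, ⟨fun a ha g => ⟨hAnormal.conj_mem a ha.1 g, ?_⟩⟩, ?_, ?_, fun a ha => ha.2⟩
  · rw [conj_pow, ha.2, mul_one, mul_inv_cancel]
  · intro hbot
    have hxN : (x : G) ∈ N := ⟨x.2, by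
      rw [← Subgroup.coe_pow, ← hx, pow_orderOf_eq_one, Subgroup.coe_one]⟩
    rw [hbot, Subgroup.mem_bot] at hxN
    have : x = 1 := Subtype.ext hxN
    rw [this, orderOf_one] at hx
    exact hp.one_lt.ne hx
  · exact fun a ha b hb => hcomm a ha.1 b hb.1

theorem card_mulAut_le_of_elementary_abelian {N : Type*} [Group N] [Finite N] {p k : ℕ}
    (hp : p.Prime) (hcomm : ∀ a b : N, a * b = b * a) (hpow : ∀ a : N, a ^ p = 1)
    (hcard : Nat.card N = p ^ k) :
    Nat.card (MulAut N) ≤ ∏ i : Fin k, (p ^ k - p ^ (i : ℕ)) := by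
  have := Fact.mk hp
  let _ : CommGroup N := { ‹Group N› with mul_comm := hcomm }
  let _ : Module (ZMod p) (Additive N) :=
    AddCommGroup.zmodModule (n := p) fun a => congrArg Additive.ofMul (hpow a.toMul)
  have : Module.Finite (ZMod p) (Additive N) := Module.Finite.of_finite
  have hfin : Module.finrank (ZMod p) (Additive N) = k := by
    have h := Module.natCard_eq_pow_finrank (K := ZMod p) (V := Additive N)
    rw [Nat.card_zmod] at h
    have h2 : Nat.card (Additive N) = p ^ k := hcard
    rw [h2] at h
    exact (Nat.pow_right_injective hp.two_le h).symm
  have hGL := Matrix.card_GL_field (𝔽 := ZMod p) k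
  rw [ZMod.card] at hGL
  rw [← hGL]
  let b := Module.finBasisOfFinrankEq (ZMod p) (Additive N) hfin
  let f : MulAut N → (Additive N ≃ₗ[ZMod p] Additive N) := fun φ =>
    { (MulEquiv.toAdditive φ) with
      map_smul' := fun c x => ZMod.map_smul (MulEquiv.toAdditive φ : Additive N →+ Additive N) c x }
  have hf : Function.Injective f := by
    intro φ ψ h
    ext x
    exact congrArg (fun e : Additive N ≃ₗ[ZMod p] Additive N => (e (Additive.ofMul x)).toMul) h
  let e : (Additive N ≃ₗ[ZMod p] Additive N) → GL (Fin k) (ZMod p) := fun T =>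
    (Units.mapEquiv (LinearMap.toMatrixAlgEquiv b).toMulEquiv)
      ((LinearMap.GeneralLinearGroup.generalLinearEquiv _ _).symm T)
  have he : Function.Injective e :=
    (MulEquiv.injective _).comp (MulEquiv.injective _)
  exact Nat.card_le_card_of_injective _ (he.comp hf)

/-- A finite solvable primitive permutation group has prime power degree `p ^ k`, and order
at most that of the affine group of dimension `k` over the field with `p` elements. -/
theorem card_le_of_isPreprimitive_of_isSolvable {G X : Type*} [Group G] [Finite X]
    [Nontrivial X] [MulAction G X] [FaithfulSMul G X] [Group.IsSolvable G]
    (hG : IsPreprimitive G X) :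
    ∃ p k : ℕ, p.Prime ∧ Nat.card X = p ^ k ∧
      Nat.card G ≤ p ^ k * ∏ i : Fin k, (p ^ k - p ^ (i : ℕ)) := by
  have : Finite G := Finite.of_injective _ (MulAction.toPerm_injective (α := G) (β := X))
  obtain ⟨x, y, hxy⟩ := exists_pair_ne X
  have : Nontrivial G := by
    obtain ⟨g, hg⟩ := exists_smul_eq G x y
    exact ⟨g, 1, fun h => hxy (by rw [← hg, h, one_smul])⟩
  obtain ⟨p, N, hp, hN, hNbot, hcomm, hpow⟩ := exists_normal_elementary_abelian G
  have := Fact.mk hp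
  have htrans : IsPretransitive N X := by
    apply IsQuasiPreprimitive.isPretransitive_of_normal (G := G)
    intro hfix
    apply hNbot
    rw [Subgroup.eq_bot_iff_forall]
    intro a ha
    apply FaithfulSMul.eq_of_smul_eq_smul (α := X)
    intro z
    have : z ∈ fixedPoints N X := hfix ▸ Set.mem_univ z
    rw [one_smul]
    exact this ⟨a, ha⟩
  have hreg : Function.Bijective fun a : N => a • x := by
    refine ⟨fun a b hab => ?_, fun z => exists_smul_eq N x z⟩
    ext
    apply FaithfulSMul.eq_of_smul_eq_smul (α := X)
    intro z
    obtain ⟨c, rfl⟩ := exists_smul_eq N x z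
    change a • c • x = b • c • x
    rw [smul_smul, smul_smul, show a * c = c * a from Subtype.ext (hcomm a a.2 c c.2),
      show b * c = c * b from Subtype.ext (hcomm b b.2 c c.2), ← smul_smul, ← smul_smul]
    exact congrArg (c • ·) hab
  have hcardN : Nat.card N = Nat.card X := Nat.card_eq_of_bijective _ hreg
  have hpG : IsPGroup p N := fun a => ⟨1, by
    rw [pow_one]; exact Subtype.ext (by simpa using hpow a a.2)⟩
  obtain ⟨k, hk⟩ := IsPGroup.iff_card.1 hpG
  refine ⟨p, k, hp, hcardN ▸ hk, ?_⟩
  have hstab : Function.Injective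
      ((MulAut.conjNormal (H := N)).comp (stabilizer G x).subtype) := by
    rw [injective_iff_map_eq_one]
    intro g hg
    ext
    apply FaithfulSMul.eq_of_smul_eq_smul (α := X)
    intro z
    obtain ⟨c, rfl⟩ := exists_smul_eq N x z
    have h1 := congrArg (fun φ : MulAut N => ((φ c : N) : G)) hg
    simp only [MonoidHom.comp_apply, MulAut.conjNormal_apply, MulAut.one_apply,
      Subgroup.coe_subtype] at h1
    have h2 : (g : G) * c = c * g := mul_inv_eq_iff_eq_mul.1 h1
    change (g : G) • (c : G) • x = (1 : G) • (c : G) • x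
    rw [smul_smul, h2, ← smul_smul, one_smul]
    congr 1
    exact g.2
  have haut := card_mulAut_le_of_elementary_abelian hp
    (fun a b : N => Subtype.ext (hcomm a a.2 b b.2))
    (fun a : N => Subtype.ext (by simpa using hpow a a.2)) hk
  have horb : Nat.card G = Nat.card X * Nat.card (stabilizer G x) := by
    rw [← index_stabilizer_of_transitive G x, mul_comm, Subgroup.card_mul_index]
  rw [horb, ← hcardN, hk]
  exact Nat.mul_le_mul_left _ ((Nat.card_le_card_of_injective _ hstab).trans haut)

end PrimitiveSolvable

section DixonBound

open MulAction
open scoped Pointwise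

/-- The upper bound for the cube of the order of a solvable permutation group of degree `n`. -/
def solvableCubeBound : ℕ → ℕ
  | 0 => 1
  | 1 => 1
  | 2 => 2 ^ 3
  | 3 => 6 ^ 3
  | 4 => 24 ^ 3
  | 5 => 24 ^ 3
  | 6 => 72 ^ 3
  | 7 => 144 ^ 3
  | 8 => 1344 ^ 3
  | n + 9 => 24 ^ (n + 8)

theorem solvableCubeBound_of_nine_le {n : ℕ} (hn : 9 ≤ n) :
    solvableCubeBound n = 24 ^ (n - 1) := by
  obtain ⟨m, rfl⟩ := Nat.exists_eq_add_of_le' hn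
  rfl

theorem solvableCubeBound_le (n : ℕ) : solvableCubeBound n ≤ 24 ^ (n - 1) := by
  by_cases hn : 9 ≤ n
  · exact (solvableCubeBound_of_nine_le hn).le
  · interval_cases n <;> norm_num [solvableCubeBound]

theorem solvableCubeBound_mul_le (a b : ℕ) :
    solvableCubeBound a * solvableCubeBound b ≤ solvableCubeBound (a + b) := by
  rcases Nat.eq_zero_or_pos a with rfl | ha
  · simp [solvableCubeBound]
  rcases Nat.eq_zero_or_pos b with rfl | hb
  · simp [solvableCubeBound]
  by_cases hn : 9 ≤ a + b
  · rw [solvableCubeBound_of_nine_le hn]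
    calc _ ≤ 24 ^ (a - 1) * 24 ^ (b - 1) :=
          Nat.mul_le_mul (solvableCubeBound_le a) (solvableCubeBound_le b)
      _ = 24 ^ (a - 1 + (b - 1)) := (pow_add _ _ _).symm
      _ ≤ _ := Nat.pow_le_pow_right (by norm_num) (by omega)
  · have ha' : a ≤ 8 := by omega
    have hb' : b ≤ 8 := by omega
    interval_cases a <;> interval_cases b <;> first | omega | norm_num [solvableCubeBound]

theorem solvableCubeBound_mul_pow_le {a b : ℕ} (ha : 2 ≤ a) (hb : 2 ≤ b) :
    solvableCubeBound b * solvableCubeBound a ^ b ≤ solvableCubeBound (a * b) := by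
  by_cases hn : 9 ≤ a * b
  · rw [solvableCubeBound_of_nine_le hn]
    calc _ ≤ 24 ^ (b - 1) * (24 ^ (a - 1)) ^ b :=
          Nat.mul_le_mul (solvableCubeBound_le b) (Nat.pow_le_pow_left (solvableCubeBound_le a) b)
      _ = 24 ^ (b - 1 + (a - 1) * b) := by rw [← pow_mul, ← pow_add]
      _ ≤ _ := Nat.pow_le_pow_right (by norm_num) (by
          obtain ⟨a, rfl⟩ := Nat.exists_eq_add_of_le' ha
          obtain ⟨b, rfl⟩ := Nat.exists_eq_add_of_le' hb
          have : (a + 2) * (b + 2) = (a + 2 - 1) * (b + 2) + (b + 2) := by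
            rw [show a + 2 - 1 = a + 1 by omega]; ring
          omega)
  · have ha' : a ≤ 4 := by nlinarith
    have hb' : b ≤ 4 := by nlinarith
    interval_cases a <;> interval_cases b <;> first | omega | norm_num [solvableCubeBound]

theorem factorial_cube_le_solvableCubeBound {n : ℕ} (hn : n ≤ 4) :
    n.factorial ^ 3 ≤ solvableCubeBound n := by
  interval_cases n <;> norm_num [solvableCubeBound, Nat.factorial]

theorem pow_six_le {n : ℕ} (hn : 5 ≤ n) : n ^ 6 ≤ 24 ^ (n - 1) := by
  induction n, hn using Nat.le_induction with
  | base => norm_num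
  | succ n hn ih =>
    have h1 : (n + 1) ^ 6 ≤ 24 * n ^ 6 := by
      have : (5 * (n + 1)) ^ 6 ≤ (6 * n) ^ 6 := Nat.pow_le_pow_left (by omega) 6
      rw [mul_pow, mul_pow] at this
      norm_num at this
      omega
    calc (n + 1) ^ 6 ≤ 24 * n ^ 6 := h1
      _ ≤ 24 * 24 ^ (n - 1) := Nat.mul_le_mul_left _ ih
      _ = 24 ^ (n + 1 - 1) := by
        rw [← pow_succ']; congr 1; omega

theorem three_mul_mul_succ_le_two_pow {k : ℕ} (hk : 4 ≤ k) :
    3 * (k * (k + 1)) ≤ 4 * (2 ^ k - 1) := by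
  induction k, hk using Nat.le_induction with
  | base => norm_num
  | succ k hk ih =>
    have : 1 ≤ 2 ^ k := Nat.one_le_two_pow
    have : 6 * (k + 1) ≤ 4 * 2 ^ k := by
      nlinarith [Nat.sub_le (2 ^ k) 1]
    rw [pow_succ]
    have h3 : 3 * ((k + 1) * (k + 1 + 1)) = 3 * (k * (k + 1)) + 6 * (k + 1) := by ring
    omega

theorem sq_le_three_pow {p : ℕ} (hp : 3 ≤ p) : p ^ 2 ≤ 3 ^ (p - 1) := by
  induction p, hp using Nat.le_induction with
  | base => norm_num
  | succ n hn ih =>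
    calc (n + 1) ^ 2 ≤ 3 * n ^ 2 := by nlinarith
      _ ≤ 3 * 3 ^ (n - 1) := Nat.mul_le_mul_left _ ih
      _ = 3 ^ (n + 1 - 1) := by rw [← pow_succ']; congr 1; omega

theorem six_mul_le_five_mul_three_pow {k : ℕ} (hk : 2 ≤ k) :
    6 * (k * (k + 1)) ≤ 5 * (3 ^ k - 1) := by
  induction k, hk using Nat.le_induction with
  | base => norm_num
  | succ k hk ih =>
    have : 1 ≤ 3 ^ k := Nat.one_le_pow _ _ (by norm_num)
    have : 12 * (k + 1) ≤ 10 * 3 ^ k := by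
      nlinarith [Nat.sub_le (3 ^ k) 1]
    rw [pow_succ]
    have h3 : 6 * ((k + 1) * (k + 1 + 1)) = 6 * (k * (k + 1)) + 12 * (k + 1) := by ring
    omega

theorem mul_succ_le_five_mul_pow {p k : ℕ} (hp : 3 ≤ p) (hk : 2 ≤ k) :
    (p - 1) * (3 * (k * (k + 1))) ≤ 5 * (p ^ k - 1) := by
  obtain ⟨q, rfl⟩ := Nat.exists_eq_add_of_le' (show 1 ≤ p by omega)
  have h1 := geom_sum_mul_add q k
  have h2 := geom_sum_mul_add 2 k
  have h3 : ∑ i ∈ Finset.range k, (2 + 1) ^ i ≤ ∑ i ∈ Finset.range k, (q + 1) ^ i :=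
    Finset.sum_le_sum fun i _ => Nat.pow_le_pow_left (by omega) i
  have h4 := six_mul_le_five_mul_three_pow hk
  rw [← h1]
  rw [show 3 ^ k = (2 + 1) ^ k by norm_num, ← h2] at h4
  simp only [Nat.add_sub_cancel] at h4 ⊢
  have h5 : 3 * (k * (k + 1)) ≤ 5 * ∑ i ∈ Finset.range k, (q + 1) ^ i := by omega
  calc q * (3 * (k * (k + 1))) ≤ q * (5 * ∑ i ∈ Finset.range k, (q + 1) ^ i) :=
        Nat.mul_le_mul_left _ h5
    _ = _ := by ring

theorem pow_le_pow_of_three_le {p k : ℕ} (hp : 3 ≤ p) (hk : 2 ≤ k) :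
    p ^ (3 * (k * (k + 1))) ≤ 24 ^ (p ^ k - 1) := by
  rw [← Nat.pow_le_pow_iff_left (n := 2) (by norm_num)]
  calc (p ^ (3 * (k * (k + 1)))) ^ 2 = (p ^ 2) ^ (3 * (k * (k + 1))) := by
        rw [← pow_mul, ← pow_mul, mul_comm 2]
    _ ≤ (3 ^ (p - 1)) ^ (3 * (k * (k + 1))) := Nat.pow_le_pow_left (sq_le_three_pow hp) _
    _ = 3 ^ ((p - 1) * (3 * (k * (k + 1)))) := (pow_mul _ _ _).symm
    _ ≤ 3 ^ (5 * (p ^ k - 1)) :=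
        Nat.pow_le_pow_right (by norm_num) (mul_succ_le_five_mul_pow hp hk)
    _ = (3 ^ 5) ^ (p ^ k - 1) := pow_mul _ _ _
    _ ≤ (24 ^ 2) ^ (p ^ k - 1) := Nat.pow_le_pow_left (by norm_num) _
    _ = (24 ^ (p ^ k - 1)) ^ 2 := by rw [← pow_mul, ← pow_mul, mul_comm 2]

theorem affine_order_cube_le_solvableCubeBound {p k : ℕ} (hp : p.Prime) (h5 : 5 ≤ p ^ k) :
    (p ^ k * ∏ i : Fin k, (p ^ k - p ^ (i : ℕ))) ^ 3 ≤ solvableCubeBound (p ^ k) := by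
  have hcrude : (p ^ k * ∏ i : Fin k, (p ^ k - p ^ (i : ℕ))) ^ 3 ≤ p ^ (3 * (k * (k + 1))) := by
    calc _ ≤ (p ^ k * ∏ _i : Fin k, p ^ k) ^ 3 := by
          gcongr with i
          exact Nat.sub_le _ _
      _ = _ := by
        rw [Finset.prod_const, Finset.card_univ, Fintype.card_fin]
        ring
  rcases Nat.lt_or_ge k 2 with hk | hk
  · interval_cases k
    · simp at h5
    · rw [pow_one] at h5
      rcases Nat.lt_or_ge p 9 with h9 | h9
      · interval_cases p <;> norm_num [solvableCubeBound]
      · rw [pow_one, solvableCubeBound_of_nine_le h9]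
        rw [pow_one] at hcrude
        exact hcrude.trans (pow_six_le h5)
  rcases Nat.lt_or_ge p 3 with h3 | h3
  · obtain rfl : p = 2 := by have := hp.two_le; omega
    rcases Nat.lt_or_ge k 4 with hk4 | hk4
    · interval_cases k
      · norm_num at h5
      · simp [Fin.prod_univ_succ, solvableCubeBound]
    · rw [solvableCubeBound_of_nine_le (le_trans (by norm_num)
        (Nat.pow_le_pow_right (n := 2) (by norm_num) hk4))]
      refine hcrude.trans ?_
      calc 2 ^ (3 * (k * (k + 1))) ≤ 2 ^ (4 * (2 ^ k - 1)) :=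
            Nat.pow_le_pow_right (by norm_num) (three_mul_mul_succ_le_two_pow hk4)
        _ = 16 ^ (2 ^ k - 1) := by rw [pow_mul]; norm_num
        _ ≤ _ := Nat.pow_le_pow_left (by norm_num) _
  · rw [solvableCubeBound_of_nine_le (le_trans (by norm_num : 9 ≤ 3 ^ 2)
        ((Nat.pow_le_pow_left h3 2).trans (Nat.pow_le_pow_right (by omega) hk)))]
    refine hcrude.trans ?_
    exact pow_le_pow_of_three_le h3 hk

/-- The order of a permutation group preserving the fibers of a map is bounded by the order of
its action on the base times the orders of solvable groups acting on the fibers. -/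
theorem card_cube_le_of_fibration {G X Y : Type*} [Group G] [Finite X] [Fintype Y]
    [MulAction G X] [FaithfulSMul G X] [Group.IsSolvable G] (π : X → Y) (ψ : G →* Equiv.Perm Y)
    (hπ : ∀ g x, π (g • x) = ψ g (π x)) {c : ℕ} {f : Y → ℕ} (hc : Nat.card ψ.range ^ 3 ≤ c)
    (hf : ∀ y (H : Subgroup (Equiv.Perm {x // π x = y})), Group.IsSolvable H →
      Nat.card H ^ 3 ≤ f y) :
    Nat.card G ^ 3 ≤ c * ∏ y, f y := by
  have : Finite G := Finite.of_injective _ (MulAction.toPerm_injective (α := G) (β := X))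
  have hker (g : ψ.ker) (x : X) : π (g • x) = π x := by
    rw [Subgroup.smul_def, hπ, (MonoidHom.mem_ker).1 g.2, Equiv.Perm.one_apply]
  let act (y : Y) : MulAction ψ.ker {x // π x = y} :=
    { smul := fun g x => ⟨g • (x : X), (hker g x).trans x.2⟩
      one_smul := fun x => Subtype.ext (one_smul _ (x : X))
      mul_smul := fun g h x => Subtype.ext (mul_smul g h (x : X)) }
  let r (y : Y) : ψ.ker →* Equiv.Perm {x // π x = y} := MulAction.toPermHom _ _
  have hr (y : Y) (g : ψ.ker) (x : {x // π x = y}) : ((r y g x : X)) = g • (x : X) := rfl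
  have hinj : Function.Injective fun (g : ψ.ker) (y : Y) => (r y).rangeRestrict g := by
    intro g h hgh
    ext
    apply FaithfulSMul.eq_of_smul_eq_smul (α := X)
    intro x
    have h1 : r (π x) g = r (π x) h := congrArg Subtype.val (congrFun hgh (π x))
    have h2 := congrArg (fun σ : Equiv.Perm {z // π z = π x} => (σ ⟨x, rfl⟩ : X)) h1
    exact h2
  have hle : Nat.card ψ.ker ≤ ∏ y, Nat.card (r y).range :=
    (Nat.card_le_card_of_injective _ hinj).trans Nat.card_pi.le
  have hG : Nat.card G = Nat.card ψ.range * Nat.card ψ.ker := by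
    rw [← Subgroup.index_ker, mul_comm, Subgroup.card_mul_index]
  rw [hG, mul_pow]
  refine Nat.mul_le_mul hc ((Nat.pow_le_pow_left hle 3).trans ?_)
  rw [← Finset.prod_pow]
  exact Finset.prod_le_prod' fun y _ => hf y _
    (Group.isSolvable_of_surjective (r y).rangeRestrict_surjective)

/-- Dixon's bound: the order of a solvable permutation group of degree `n` is at most
`24 ^ ((n - 1) / 3)`, with a sharper value for small `n`. -/
theorem card_cube_le_solvableCubeBound {X : Type*} [Finite X] (H : Subgroup (Equiv.Perm X))
    [Group.IsSolvable H] : Nat.card H ^ 3 ≤ solvableCubeBound (Nat.card X) := by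
  induction hn : Nat.card X using Nat.strong_induction_on generalizing X with
  | _ n ih =>
  subst hn
  classical
  have := Fintype.ofFinite X
  rcases Nat.lt_or_ge (Nat.card X) 5 with h5 | h5
  · refine le_trans (Nat.pow_le_pow_left ?_ 3) (factorial_cube_le_solvableCubeBound (by omega))
    rw [← Nat.card_perm]
    exact Subgroup.card_le_card_group H
  have hnt : Nontrivial X := Finite.one_lt_card_iff_nontrivial.1 (by omega)
  by_cases htr : IsPretransitive H X
  · by_cases hpr : IsPreprimitive H X
    · obtain ⟨p, k, hp, hX, hle⟩ := card_le_of_isPreprimitive_of_isSolvable hpr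
      rw [hX] at h5 ⊢
      exact (Nat.pow_le_pow_left hle 3).trans (affine_order_cube_le_solvableCubeBound hp h5)
    · obtain ⟨B, hB, hBs, hBu⟩ : ∃ B : Set X, IsBlock H B ∧ ¬ B.Subsingleton ∧ B ≠ Set.univ := by
        by_contra! hcon
        exact hpr ⟨fun {B} hB => or_iff_not_imp_left.2 fun h =>
          hcon B hB (Set.not_subsingleton_iff.1 h)⟩
      have hBne : B.Nonempty := (Set.not_subsingleton_iff.1 hBs).nonempty
      obtain ⟨⟨-, hpart⟩, -⟩ := hB.isBlockSystem hBne
      let Y := orbit H B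
      have := Fintype.ofFinite Y
      have hY (x : X) : ∃ y : Y, x ∈ (y : Set X) := by
        obtain ⟨S, ⟨hS, hxS⟩, -⟩ := hpart x
        obtain ⟨g, rfl⟩ := hS
        exact ⟨⟨_, mem_orbit B g⟩, hxS⟩
      choose π hxπ using hY
      have hπ' (x : X) (y : Y) (hxy : x ∈ (y : Set X)) : π x = y := by
        obtain ⟨S, -, hS⟩ := hpart x
        have h1 := hS (π x : Set X) ⟨(π x).2, hxπ x⟩
        have h2 := hS (y : Set X) ⟨y.2, hxy⟩
        exact Subtype.ext (h1.trans h2.symm)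
      have hfib (y : Y) : Nat.card {x // π x = y} = B.ncard := by
        have : {x | π x = y} = (y : Set X) := by
          ext x
          exact ⟨fun h => h ▸ hxπ x, hπ' x y⟩
        change Nat.card {x | π x = y} = _
        rw [this, Nat.card_coe_set_eq]
        obtain ⟨g, hg⟩ := y.2
        rw [← hg]
        exact Set.ncard_smul_set g B
      have hcard : B.ncard * Nat.card Y = Nat.card X := by
        rw [← hB.ncard_block_mul_ncard_orbit_eq hBne, Nat.card_coe_set_eq]
      have hB2 : 2 ≤ B.ncard := by
        rw [← not_lt, Nat.lt_succ_iff, Set.ncard_le_one_iff_subsingleton]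
        exact hBs
      have hBlt : B.ncard < Nat.card X := by
        rw [← Set.ncard_univ]
        exact Set.ncard_lt_ncard (Set.ssubset_univ_iff.2 hBu)
      have hY2 : 2 ≤ Nat.card Y := by
        by_contra! h
        have : B.ncard * Nat.card Y ≤ B.ncard * 1 := Nat.mul_le_mul_left _ (by omega)
        omega
      have hYlt : Nat.card Y < Nat.card X := by
        have : 2 * Nat.card Y ≤ B.ncard * Nat.card Y := Nat.mul_le_mul_right _ hB2
        omega
      have hsol : Group.IsSolvable (MulAction.toPermHom H Y).range :=
        Group.isSolvable_of_surjective (MonoidHom.rangeRestrict_surjective _)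
      have := card_cube_le_of_fibration π (MulAction.toPermHom H Y)
        (fun g x => hπ' _ _ (Set.smul_mem_smul_set (hxπ x)))
        (ih _ hYlt (MulAction.toPermHom H Y).range rfl)
        (f := fun _ => solvableCubeBound B.ncard)
        (fun y K hK => ih _ hBlt K (hfib y))
      refine this.trans ?_
      rw [Finset.prod_const, Finset.card_univ, ← Nat.card_eq_fintype_card, ← hcard]
      exact solvableCubeBound_mul_pow_le hB2 hY2
  · obtain ⟨x, z, hxz⟩ : ∃ x z : X, z ∉ orbit H x := by
      by_contra! h
      exact htr ⟨fun x z => h x z⟩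
    let π : X → Bool := fun w => decide (w ∈ orbit H x)
    have hsum : Nat.card {w // π w = true} + Nat.card {w // π w = false} = Nat.card X := by
      rw [← Nat.card_sum]
      refine Nat.card_congr
        ((Equiv.sumCongr (Equiv.refl _) (Equiv.subtypeEquivRight fun w => ?_)).trans
        (Equiv.sumCompl fun w => π w = true))
      simp
    have hpos1 : 0 < Nat.card {w // π w = true} :=
      Nat.card_pos_iff.2 ⟨⟨x, decide_eq_true (mem_orbit_self x)⟩, inferInstance⟩
    have hpos2 : 0 < Nat.card {w // π w = false} :=
      Nat.card_pos_iff.2 ⟨⟨z, decide_eq_false hxz⟩, inferInstance⟩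
    have := card_cube_le_of_fibration (G := H) π 1
      (fun g w => by
        change decide (g • w ∈ orbit H x) = decide (w ∈ orbit H x)
        rw [← orbit_eq_iff, ← orbit_eq_iff, orbit_smul]) (c := 1) (by simp)
      (f := fun y => solvableCubeBound (Nat.card {w // π w = y}))
      (fun y K hK => ih _ (by cases y <;> omega) K rfl)
    refine this.trans ?_
    rw [Fintype.prod_bool, one_mul, ← hsum]
    exact solvableCubeBound_mul_le _ _

end DixonBound

section AlternatingAutomorphisms

open Equiv Equiv.Perm

theorem two_mul_three_pow_mul_factorial_lt {k : ℕ} (hk : 3 ≤ k) :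
    2 * (3 ^ k * k.factorial) < 3 * (3 * k - 3).factorial := by
  induction k, hk using Nat.le_induction with
  | base => norm_num [Nat.factorial]
  | succ k hk ih =>
    have h1 : 3 * (k + 1) - 3 = (3 * k - 3) + 1 + 1 + 1 := by omega
    rw [h1, Nat.factorial_succ, Nat.factorial_succ, Nat.factorial_succ, Nat.factorial_succ]
    set f := (3 * k - 3).factorial
    have h2 : 3 * (k + 1) ≤ (3 * k - 3 + 1 + 1 + 1) * (3 * k - 3 + 1 + 1) := by
      obtain ⟨m, rfl⟩ := Nat.exists_eq_add_of_le' hk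
      have : 3 * (m + 3) - 3 = 3 * m + 6 := by omega
      rw [this]
      nlinarith
    calc 2 * (3 ^ (k + 1) * ((k + 1) * k.factorial))
        = 3 * (k + 1) * (2 * (3 ^ k * k.factorial)) := by ring
      _ < 3 * (k + 1) * (3 * f) := Nat.mul_lt_mul_of_pos_left ih (by positivity)
      _ ≤ ((3 * k - 3 + 1 + 1 + 1) * (3 * k - 3 + 1 + 1)) * (3 * f) := Nat.mul_le_mul_right _ h2
      _ ≤ ((3 * k - 3 + 1 + 1 + 1) * (3 * k - 3 + 1 + 1)) * (3 * f) * (3 * k - 3 + 1) :=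
        Nat.le_mul_of_pos_right _ (by positivity)
      _ = _ := by ring

theorem two_mul_centralizer_order_lt {n k : ℕ} (hn : 7 ≤ n) (hk : 2 ≤ k) (hkn : 3 * k ≤ n) :
    2 * ((n - 3 * k).factorial * 3 ^ k * k.factorial) < (n - 3).factorial * 3 := by
  rcases Nat.lt_or_ge k 3 with h | h
  · obtain rfl : k = 2 := by omega
    obtain ⟨m, rfl⟩ := Nat.exists_eq_add_of_le' hn
    rw [show m + 7 - 3 = (m + 1) + 1 + 1 + 1 by omega, show m + 7 - 3 * 2 = m + 1 by omega,
      Nat.factorial_succ (m + 1 + 1 + 1), Nat.factorial_succ (m + 1 + 1),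
      Nat.factorial_succ (m + 1)]
    have := Nat.factorial_pos (m + 1)
    generalize (m + 1).factorial = f at *
    norm_num [Nat.factorial]
    nlinarith [Nat.zero_le (m * f), Nat.zero_le (m * m * f), Nat.zero_le (m * m * m * f)]
  · have h1 := Nat.factorial_mul_factorial_dvd_factorial_add (n - 3 * k) (3 * k - 3)
    rw [show n - 3 * k + (3 * k - 3) = n - 3 by omega] at h1
    have h2 := Nat.le_of_dvd (Nat.factorial_pos _) h1
    calc 2 * ((n - 3 * k).factorial * 3 ^ k * k.factorial)
        = (n - 3 * k).factorial * (2 * (3 ^ k * k.factorial)) := by ring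
      _ < (n - 3 * k).factorial * (3 * (3 * k - 3).factorial) :=
        Nat.mul_lt_mul_of_pos_left (two_mul_three_pow_mul_factorial_lt h) (Nat.factorial_pos _)
      _ = (n - 3 * k).factorial * (3 * k - 3).factorial * 3 := by ring
      _ ≤ _ := Nat.mul_le_mul_right _ h2

variable {α : Type*} [Fintype α] [DecidableEq α]

theorem card_centralizer_alternatingGroup_le (g : alternatingGroup α) :
    Nat.card (Subgroup.centralizer {g}) ≤ Nat.card (Subgroup.centralizer {(g : Perm α)}) := by
  refine Nat.card_le_card_of_injective (fun h => ⟨(h : alternatingGroup α), ?_⟩) fun h₁ h₂ h => ?_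
  · exact Subgroup.mem_centralizer_singleton_iff.2
      (congrArg Subtype.val (Subgroup.mem_centralizer_singleton_iff.1 h.2))
  · exact Subtype.ext (Subtype.ext (congrArg (fun x => (x.1 : Perm α)) h))

theorem card_centralizer_le_two_mul [Nontrivial α] (g : alternatingGroup α) :
    Nat.card (Subgroup.centralizer {(g : Perm α)}) ≤
      2 * Nat.card (Subgroup.centralizer {g}) := by
  set K := Subgroup.centralizer {(g : Perm α)}
  have h1 : Nat.card ((alternatingGroup α).subgroupOf K) * (alternatingGroup α).relIndex K =
      Nat.card K := Subgroup.card_mul_index _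
  have h2 : (alternatingGroup α).relIndex K ≤ 2 := by
    rw [← alternatingGroup.index_eq_two (α := α)]
    exact Nat.le_of_dvd (by rw [alternatingGroup.index_eq_two]; norm_num)
      (Subgroup.relIndex_dvd_index_of_normal _ _)
  have h3 : Nat.card ((alternatingGroup α).subgroupOf K) ≤ Nat.card (Subgroup.centralizer {g}) := by
    refine Nat.card_le_card_of_injective
      (fun h => ⟨⟨h, Subgroup.mem_subgroupOf.1 h.2⟩, ?_⟩) fun h₁ h₂ h => ?_
    · exact Subgroup.mem_centralizer_singleton_iff.2
        (Subtype.ext (Subgroup.mem_centralizer_singleton_iff.1 h.1.2))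
    · exact Subtype.ext (Subtype.ext (congrArg (fun x => (x.1.1 : Perm α)) h))
  rw [← h1, mul_comm]
  exact Nat.mul_le_mul h2 h3

/-- For `n ≥ 7`, automorphisms of the alternating group preserve the class of 3-cycles. -/
theorem isThreeCycle_mulAut_apply (hα : 7 ≤ Fintype.card α) (φ : MulAut (alternatingGroup α))
    {g : alternatingGroup α} (hg : (g : Perm α).IsThreeCycle) :
    (φ g : Perm α).IsThreeCycle := by
  have : Nontrivial α := Fintype.one_lt_card_iff_nontrivial.1 (by omega)
  have hord : orderOf (φ g : Perm α) = 3 := by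
    rw [Subgroup.orderOf_coe, MulEquiv.orderOf_eq, ← Subgroup.orderOf_coe]
    exact hg.orderOf
  obtain ⟨k, hk⟩ := cycleType_prime_order (σ := (φ g : Perm α)) (by rw [hord]; norm_num)
  rw [hord] at hk
  by_contra hcon
  have hk0 : k ≠ 0 := by
    rintro rfl
    exact hcon hk
  have hcardφ : Nat.card (Subgroup.centralizer {φ g}) = Nat.card (Subgroup.centralizer {g}) := by
    refine (Nat.card_congr (φ.toEquiv.subtypeEquiv fun h => ?_)).symm
    change h ∈ Subgroup.centralizer {g} ↔ φ h ∈ Subgroup.centralizer {φ g}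
    rw [Subgroup.mem_centralizer_singleton_iff, Subgroup.mem_centralizer_singleton_iff,
      ← map_mul, ← map_mul, φ.injective.eq_iff]
  have h1 := nat_card_centralizer (g : Perm α)
  have h2 := nat_card_centralizer (φ g : Perm α)
  have hle : (k + 1) * 3 ≤ Fintype.card α := by
    have := sum_cycleType_le (φ g : Perm α)
    rwa [hk, Multiset.sum_replicate, smul_eq_mul] at this
  rw [hg.cycleType] at h1
  rw [hk, Multiset.toFinset_replicate, if_neg (by omega), Finset.prod_singleton,
    Multiset.count_replicate_self, Multiset.prod_replicate, Multiset.sum_replicate,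
    smul_eq_mul, mul_comm (k + 1)] at h2
  simp only [Multiset.sum_singleton, Multiset.prod_singleton, Multiset.toFinset_singleton,
    Finset.prod_singleton, Multiset.count_singleton_self, Nat.factorial_one, mul_one] at h1
  have h3 := card_centralizer_le_two_mul g
  have h4 := card_centralizer_alternatingGroup_le (φ g)
  have h5 := two_mul_centralizer_order_lt hα (show 2 ≤ k + 1 by omega) (by omega)
  omega

theorem Equiv.Perm.IsThreeCycle.apply_apply_apply {s : Perm α} (hs : s.IsThreeCycle) (x : α) :
    s (s (s x)) = x := by
  have : (s ^ 3) x = x := by rw [← hs.orderOf, pow_orderOf_eq_one, one_apply]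
  simpa [pow_succ] using this

theorem Equiv.Perm.IsThreeCycle.apply_eq_self {s : Perm α} (hs : s.IsThreeCycle) {a x : α}
    (ha : s a ≠ a) (h1 : x ≠ a) (h2 : x ≠ s a) (h3 : x ≠ s (s a)) : s x = x := by
  rw [← notMem_support, hs.support_eq_iff_mem_support.2 (mem_support.2 ha)]
  simp [h1, h2, h3]

/-- Two 3-cycles whose product is an involution agree at some point which they move. -/
theorem exists_apply_eq_apply_of_isThreeCycle {s t : Perm α} (hs : s.IsThreeCycle)
    (ht : t.IsThreeCycle) (hst : s * t ≠ 1) (hst2 : (s * t) ^ 2 = 1) :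
    ∃ x, s x ≠ x ∧ t x = s x := by
  have hinv (x : α) : s (t (s (t x))) = x := by
    have := congrArg (fun σ : Perm α => σ x) hst2
    simpa [pow_two] using this
  have key (x : α) : t (s (t x)) = s (s x) :=
    s.injective (by rw [hinv, hs.apply_apply_apply])
  have hfix (x : α) (hx : s x ≠ x) (htx : t x = x) : ∃ y, s y ≠ y ∧ t y = s y := by
    refine ⟨s x, fun h => hx (s.injective h), ?_⟩
    rw [← key x, htx]
  obtain ⟨a, ha⟩ : ∃ a, s a ≠ a := by
    by_contra! h
    exact hs.ne_one (Equiv.ext h)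
  by_contra hcon
  have hmove (x : α) (hx : s x ≠ x) : t x ≠ x := fun htx => hcon (hfix x hx htx)
  have hne (x : α) (hx : s x ≠ x) : t x ≠ s x := fun h => hcon ⟨x, hx, h⟩
  have hsupp : s.support = t.support := by
    apply Finset.eq_of_subset_of_card_le
    · intro x hx
      exact mem_support.2 (hmove x (mem_support.1 hx))
    · rw [hs.card_support, ht.card_support]
  apply hst
  ext x
  by_cases hx : t x = x
  · have : s x = x := by rwa [← notMem_support, hsupp, notMem_support]
    simp [hx, this]
  · have hsx : s x ≠ x := by rwa [← mem_support, hsupp, mem_support]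
    have h1 : t x = s (s x) := by
      by_contra h
      have h2 : s (t x) = t x := hs.apply_eq_self hsx hx (hne x hsx) h
      have h3 : t x ∈ t.support := apply_mem_support.2 (mem_support.2 hx)
      rw [← hsupp, mem_support] at h3
      exact h3 h2
    simp [h1, hs.apply_apply_apply]

/-- If three 3-cycles have pairwise products which are involutions, then the third one agrees
with the first two at every point moved on which these agree. -/
theorem apply_eq_of_isThreeCycle_of_pairwise {s t u : Perm α} (hs : s.IsThreeCycle)
    (ht : t.IsThreeCycle) (hu : u.IsThreeCycle) (hst : s ≠ t) {x : α} (hx : s x ≠ x)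
    (hxt : t x = s x) (hsu : ∃ y, s y ≠ y ∧ u y = s y) (htu : ∃ y, t y ≠ y ∧ u y = t y) :
    u x = s x := by
  have hs3 := hs.apply_apply_apply
  have ht3 := ht.apply_apply_apply
  have hu3 := hu.apply_apply_apply
  have hne : s (s x) ≠ t (t x) := by
    intro h
    apply hst
    rw [hs.eq_swap_mul_swap_iff_mem_support.2 (mem_support.2 hx),
      ht.eq_swap_mul_swap_iff_mem_support.2 (mem_support.2 (hxt ▸ hx)), ← h, hxt]
  obtain ⟨y, hy, hyu⟩ := hsu
  obtain ⟨z, hz, hzu⟩ := htu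
  have hyx : y = x ∨ y = s x ∨ y = s (s x) := by
    by_contra! h
    exact hy (hs.apply_eq_self hx h.1 h.2.1 h.2.2)
  have htx : t x ≠ x := hxt ▸ hx
  have hzx : z = x ∨ z = t x ∨ z = t (t x) := by
    by_contra! h
    exact hz (ht.apply_eq_self htx h.1 h.2.1 h.2.2)
  have hfu {a b : α} (ha : u a ≠ a) (hb : u b ≠ b) : b = a ∨ b = u a ∨ b = u (u a) := by
    by_contra! h
    exact hb (hu.apply_eq_self ha h.1 h.2.1 h.2.2)
  have hsx := hs3 x
  have htx3 := ht3 x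
  have hss : s (s x) ≠ s x := fun h => hx (s.injective h)
  have hss' : s (s x) ≠ x := fun h => hx (by rw [← h, hsx, h])
  have htt : t (t x) ≠ t x := fun h => htx (t.injective h)
  have htt' : t (t x) ≠ x := fun h => htx (by rw [← h, htx3, h])
  rcases hyx with rfl | rfl | rfl
  · exact hyu
  · rcases hzx with rfl | rfl | rfl
    · exact hzu.trans hxt
    · exact absurd (by rw [← hyu, ← hzu, hxt]) hne
    · have := hu3 (s x)
      rcases hfu (a := s x) (b := t (t x)) (by rw [hyu]; exact hy) (by rw [hzu]; exact hz)
        with h | h | h <;> grind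
  · rcases hzx with rfl | rfl | rfl
    · exact hzu.trans hxt
    · have := hu3 (s (s x))
      rcases hfu (a := s (s x)) (b := t x) (by rw [hyu]; exact hy) (by rw [hzu]; exact hz)
        with h | h | h <;> grind
    · exact absurd (u.injective (by rw [hyu, hzu, htx3, hsx])) hne

/-- A subgroup of the alternating group containing all `(a i) (a j)`, for a fixed `a`, is the
whole alternating group. -/
theorem eq_top_of_swap_mul_swap_mem {K : Subgroup (alternatingGroup α)} (a : α)
    (hK : ∀ i j, i ≠ a → j ≠ a → ∀ g : alternatingGroup α, (g : Perm α) = swap a i * swap a j →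
      g ∈ K) : K = ⊤ := by
  rw [eq_top_iff, ← alternatingGroup.closure_isThreeCycles_eq_top, Subgroup.closure_le]
  intro g (hg : (g : Perm α).IsThreeCycle)
  have hmem {i j : α} (hi : i ≠ a) (hj : j ≠ a) : swap a i * swap a j ∈ alternatingGroup α :=
    mul_mem_alternatingGroup_of_isSwap ⟨a, i, hi.symm, rfl⟩ ⟨a, j, hj.symm, rfl⟩
  have hrep {x : α} (hx : (g : Perm α) x ≠ x) :=
    hg.eq_swap_mul_swap_iff_mem_support.2 (mem_support.2 hx)
  have hnodup {x : α} (hx : (g : Perm α) x ≠ x) :=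
    hg.nodup_iff_mem_support.2 (mem_support.2 hx)
  by_cases ha : (g : Perm α) a = a
  · obtain ⟨x, hx⟩ : ∃ x, (g : Perm α) x ≠ x := by
      by_contra! h
      exact hg.ne_one (Equiv.ext h)
    have hrepx := hrep hx
    have hnodupx := hnodup hx
    have hxa : x ≠ a := fun h => hx (h ▸ ha)
    have hua : (g : Perm α) x ≠ a := fun h => hxa ((g : Perm α).injective (h.trans ha.symm))
    have hva : (g : Perm α) ((g : Perm α) x) ≠ a :=
      fun h => hua ((g : Perm α).injective (h.trans ha.symm))
    generalize hu : (g : Perm α) x = u at *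
    generalize hv : (g : Perm α) u = v at *
    have : g = ⟨_, hmem hxa hva⟩ * ⟨_, hmem hua hxa⟩ := by
      apply Subtype.ext
      rw [hrepx]
      ext y
      simp only [Subgroup.coe_mul, coe_mul, Function.comp_apply, swap_apply_def]
      grind
    rw [this]
    exact K.mul_mem (hK _ _ hxa hva _ rfl) (hK _ _ hua hxa _ rfl)
  · have hrepa := hrep ha
    have hnodupa := hnodup ha
    refine hK ((g : Perm α) ((g : Perm α) a)) ((g : Perm α) a) (by grind) ha g ?_
    generalize hu : (g : Perm α) a = u at *
    generalize hv : (g : Perm α) u = v at *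
    rw [hrepa]
    ext y
    simp only [coe_mul, Function.comp_apply, swap_apply_def]
    grind

theorem exists_notMem_of_card_lt {s : Finset α} (hs : s.card < Fintype.card α) : ∃ x, x ∉ s := by
  by_contra! h
  rw [Finset.eq_univ_of_forall h, Finset.card_univ] at hs
  exact hs.false

/-- For `n ≥ 7`, every automorphism of the alternating group is conjugation by a permutation. -/
theorem exists_mulAut_apply_eq_conj (hα : 7 ≤ Fintype.card α) (φ : MulAut (alternatingGroup α)) :
    ∃ σ : Perm α, ∀ g, (φ g : Perm α) = σ * g * σ⁻¹ := by
  obtain ⟨a, -⟩ : ∃ a : α, a ∉ (∅ : Finset α) := exists_notMem_of_card_lt (by simp; omega)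
  obtain ⟨b, hb⟩ : ∃ b, b ∉ ({a} : Finset α) := exists_notMem_of_card_lt (by simp; omega)
  obtain ⟨i₀, hi₀⟩ : ∃ i, i ∉ ({a, b} : Finset α) :=
    exists_notMem_of_card_lt (Finset.card_le_two.trans_lt (by omega))
  obtain ⟨i₁, hi₁⟩ : ∃ i, i ∉ ({a, b, i₀} : Finset α) :=
    exists_notMem_of_card_lt (Finset.card_le_three.trans_lt (by omega))
  simp only [Finset.mem_singleton, Finset.mem_insert, not_or] at hb hi₀ hi₁
  have hmem {i : α} (hi : i ≠ a) : swap a i * swap a b ∈ alternatingGroup α :=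
    mul_mem_alternatingGroup_of_isSwap ⟨a, i, hi.symm, rfl⟩ ⟨a, b, Ne.symm hb, rfl⟩
  let T (i : α) : alternatingGroup α := if hi : i = a then 1 else ⟨_, hmem hi⟩
  have hT {i : α} (hi : i ≠ a) : (T i : Perm α) = swap a i * swap a b := by
    simp [T, hi]
  let z (i : α) : Perm α := φ (T i)
  have hz {i : α} (hia : i ≠ a) (hib : i ≠ b) : (z i).IsThreeCycle := by
    apply isThreeCycle_mulAut_apply hα
    rw [hT hia]
    exact isThreeCycle_swap_mul_swap_same hia.symm (Ne.symm hb) hib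
  have hTT {i j : α} (hia : i ≠ a) (hib : i ≠ b) (hja : j ≠ a) (hjb : j ≠ b) (hij : i ≠ j) :
      T i * T j ≠ 1 ∧ (T i * T j) ^ 2 = 1 := by
    have h : ((T i * T j : alternatingGroup α) : Perm α) = swap a i * swap b j := by
      rw [Subgroup.coe_mul, hT hia, hT hja]
      ext y
      simp only [coe_mul, Function.comp_apply, swap_apply_def]
      grind
    constructor
    · intro h1
      rw [h1] at h
      have := congrArg (fun σ : Perm α => σ b) h
      simp only [Subgroup.coe_one, one_apply, coe_mul, Function.comp_apply, swap_apply_def] at this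
      grind
    · apply Subtype.ext
      rw [Subgroup.coe_pow, h, Subgroup.coe_one]
      ext y
      simp only [pow_two, coe_mul, Function.comp_apply, swap_apply_def, one_apply]
      grind
  have hshare {i j : α} (hia : i ≠ a) (hib : i ≠ b) (hja : j ≠ a) (hjb : j ≠ b) (hij : i ≠ j) :
      ∃ x, z i x ≠ x ∧ z j x = z i x := by
    obtain ⟨h1, h2⟩ := hTT hia hib hja hjb hij
    apply exists_apply_eq_apply_of_isThreeCycle (hz hia hib) (hz hja hjb)
    · intro h
      apply h1
      apply φ.injective
      rw [map_mul, map_one]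
      exact Subtype.ext h
    · have := congrArg (fun g => (φ g : Perm α)) h2
      simpa using this
  have hzinj {i j : α} (hia : i ≠ a) (hja : j ≠ a) (h : z i = z j) : i = j := by
    have h1 : T i = T j := φ.injective (Subtype.ext h)
    have h2 : swap a i * swap a b = swap a j * swap a b := by rw [← hT hia, ← hT hja, h1]
    have h3 := congrArg (fun σ : Perm α => σ a) (mul_right_cancel h2)
    simpa using h3
  obtain ⟨a', ha', hab'⟩ := hshare hi₀.1 hi₀.2 hi₁.1 hi₁.2.1 (Ne.symm hi₁.2.2)
  set b' := z i₀ a' with hb'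
  have hza {i : α} (hia : i ≠ a) (hib : i ≠ b) : z i a' = b' := by
    by_cases h0 : i = i₀
    · rw [h0]
    by_cases h1 : i = i₁
    · rw [h1, hab']
    · exact apply_eq_of_isThreeCycle_of_pairwise (hz hi₀.1 hi₀.2) (hz hi₁.1 hi₁.2.1) (hz hia hib)
        (fun h => hi₁.2.2 (hzinj hi₀.1 hi₁.1 h).symm) ha' hab'
        (hshare hi₀.1 hi₀.2 hia hib (Ne.symm h0)) (hshare hi₁.1 hi₁.2.1 hia hib (Ne.symm h1))
  have hrep {i : α} (hia : i ≠ a) (hib : i ≠ b) :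
      z i = swap a' b' * swap b' (z i b') := by
    have := (hz hia hib).eq_swap_mul_swap_iff_mem_support (a := a') |>.2
      (mem_support.2 (by rw [hza hia hib]; exact ha'))
    rwa [hza hia hib] at this
  have hne {i : α} (hia : i ≠ a) (hib : i ≠ b) : z i b' ≠ a' ∧ z i b' ≠ b' := by
    have := (hz hia hib).nodup_iff_mem_support (a := a') |>.2
      (mem_support.2 (by rw [hza hia hib]; exact ha'))
    rw [hza hia hib] at this
    grind
  let f (i : α) : α := if i = a then a' else if i = b then b' else z i b'
  have hfa : f a = a' := by simp [f]
  have hfb : f b = b' := by simp [f, hb]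
  have hf {i : α} (hia : i ≠ a) (hib : i ≠ b) : f i = z i b' := by simp [f, hia, hib]
  have hf_ne_left {i : α} (hia : i ≠ a) : f i ≠ a' := by
    by_cases hib : i = b
    · rw [hib, hfb]
      exact ha'
    · rw [hf hia hib]
      exact (hne hia hib).1
  have hf_ne_right {i : α} (hib : i ≠ b) : f i ≠ b' := by
    by_cases hia : i = a
    · rw [hia, hfa]
      exact Ne.symm ha'
    · rw [hf hia hib]
      exact (hne hia hib).2
  have hfinj : Function.Injective f := by
    intro i j hij
    by_cases hia : i = a
    · subst hia
      by_contra hji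
      exact hf_ne_left (Ne.symm hji) (hij.symm.trans hfa)
    by_cases hja : j = a
    · subst hja
      exact absurd (hij.trans hfa) (hf_ne_left hia)
    by_cases hib : i = b
    · subst hib
      by_contra hji
      exact hf_ne_right (Ne.symm hji) (hij.symm.trans hfb)
    by_cases hjb : j = b
    · subst hjb
      exact absurd (hij.trans hfb) (hf_ne_right hib)
    rw [hf hia hib, hf hja hjb] at hij
    apply hzinj hia hja
    rw [hrep hia hib, hrep hja hjb, hij]
  let σ : Perm α := Equiv.ofBijective f (Finite.injective_iff_bijective.1 hfinj)
  have hσT {i : α} (hia : i ≠ a) : (φ (T i) : Perm α) = σ * T i * σ⁻¹ := by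
    by_cases hib : i = b
    · have : T i = 1 := Subtype.ext (by rw [hT hia, hib, swap_mul_self]; rfl)
      simp [this]
    · have h1 : σ * (T i : Perm α) * σ⁻¹ = (σ * swap a i * σ⁻¹) * (σ * swap a b * σ⁻¹) := by
        rw [hT hia]; group
      rw [h1, ← swap_apply_apply, ← swap_apply_apply]
      change z i = swap (f a) (f i) * swap (f a) (f b)
      rw [hfa, hfb, hf hia hib]
      refine (hrep hia hib).trans ?_
      have := hne hia hib
      ext y
      simp only [coe_mul, Function.comp_apply, swap_apply_def]
      grind
  refine ⟨σ, fun g => ?_⟩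
  let K := ((alternatingGroup α).subtype.comp (φ : alternatingGroup α →* _)).eqLocus
    ((MulAut.conj σ : Perm α →* Perm α).comp (alternatingGroup α).subtype)
  have hTK {i : α} (hia : i ≠ a) : T i ∈ K := hσT hia
  have hKtop : K = ⊤ := by
    refine eq_top_of_swap_mul_swap_mem a fun i j hi hj g hg => ?_
    have : g = T i * (T j)⁻¹ := by
      apply Subtype.ext
      rw [hg, Subgroup.coe_mul, Subgroup.coe_inv, hT hi, hT hj, mul_inv_rev, swap_inv, swap_inv,
        mul_assoc, swap_mul_self_mul]
    rw [this]
    exact K.mul_mem (hTK hi) (K.inv_mem (hTK hj))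
  have : g ∈ K := hKtop ▸ Subgroup.mem_top g
  exact this

theorem bijective_conjNormal_alternatingGroup (hα : 7 ≤ Fintype.card α) :
    Function.Bijective (MulAut.conjNormal : Perm α →* MulAut (alternatingGroup α)) := by
  constructor
  · rw [injective_iff_map_eq_one]
    intro σ hσ
    by_contra hne
    obtain ⟨x, hx⟩ : ∃ x, σ x ≠ x := by
      by_contra! h
      exact hne (Equiv.ext h)
    obtain ⟨y, hy⟩ : ∃ y, y ∉ ({x, σ x} : Finset α) :=
      exists_notMem_of_card_lt (Finset.card_le_two.trans_lt (by omega))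
    obtain ⟨w, hw⟩ : ∃ w, w ∉ ({x, σ x, y} : Finset α) :=
      exists_notMem_of_card_lt (Finset.card_le_three.trans_lt (by omega))
    simp only [Finset.mem_singleton, Finset.mem_insert, not_or] at hy hw
    have hmem : swap x y * swap x w ∈ alternatingGroup α :=
      mul_mem_alternatingGroup_of_isSwap ⟨x, y, Ne.symm hy.1, rfl⟩ ⟨x, w, Ne.symm hw.1, rfl⟩
    have h1 := congrArg (fun φ : MulAut (alternatingGroup α) => (φ ⟨_, hmem⟩ : Perm α)) hσ
    simp only [MulAut.conjNormal_apply, MulAut.one_apply] at h1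
    have h2 := congrArg (fun τ : Perm α => τ x) (mul_inv_eq_iff_eq_mul.1 h1)
    simp only [coe_mul, Function.comp_apply, swap_apply_left] at h2
    have h3 : σ w = σ x := by
      rw [swap_apply_of_ne_of_ne (a := x) (b := y) (x := w) (by grind) (by grind),
        swap_apply_of_ne_of_ne (a := x) (b := w) (x := σ x) (by grind) (by grind),
        swap_apply_of_ne_of_ne (a := x) (b := y) (x := σ x) (by grind) (by grind)] at h2
      exact h2
    exact hw.1 (σ.injective h3)
  · intro φ
    obtain ⟨σ, hσ⟩ := exists_mulAut_apply_eq_conj hα φ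
    exact ⟨σ, MulEquiv.ext fun g => Subtype.ext (hσ g).symm⟩

theorem maxSolvableOrder_mulAut_alternatingGroup_cube_le (hα : 7 ≤ Fintype.card α) :
    maxSolvableOrder (MulAut (alternatingGroup α)) ^ 3 ≤ solvableCubeBound (Fintype.card α) := by
  have hbound : ∀ k ∈ {k | ∃ H : Subgroup (MulAut (alternatingGroup α)),
      Group.IsSolvable H ∧ Nat.card H = k}, k ^ 3 ≤ solvableCubeBound (Fintype.card α) := by
    rintro _ ⟨H, hH, rfl⟩
    let e : MulAut (alternatingGroup α) ≃* Perm α :=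
      (MulEquiv.ofBijective _ (bijective_conjNormal_alternatingGroup hα)).symm
    let eH := H.equivMapOfInjective (e : _ →* Perm α) e.injective
    have : Group.IsSolvable (H.map (e : _ →* Perm α)) :=
      Group.isSolvable_of_surjective (f := (eH : H →* _)) eH.surjective
    rw [Nat.card_congr eH.toEquiv, ← Nat.card_eq_fintype_card]
    exact card_cube_le_solvableCubeBound _
  refine hbound _ (Nat.sSup_mem ⟨1, ⊥, inferInstance, by simp⟩
    ⟨solvableCubeBound (Fintype.card α), fun k hk => ?_⟩)
  exact (Nat.le_self_pow (by norm_num) k).trans (hbound k hk)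

end AlternatingAutomorphisms

section Numerics

open Nat

theorem pow_mul_pow_lt_factorial_pow {n : ℕ} (hn : 12 ≤ n) :
    24 ^ (10 * n) * (2 ^ (n + 1)) ^ 37 < (n !) ^ 37 := by
  induction n, hn using Nat.le_induction with
  | base => norm_num [Nat.factorial]
  | succ n hn ih =>
    have h : 24 ^ 10 * 2 ^ 37 ≤ (n + 1) ^ 37 :=
      le_trans (by norm_num) (Nat.pow_le_pow_left (show 13 ≤ n + 1 by omega) 37)
    calc 24 ^ (10 * (n + 1)) * (2 ^ (n + 1 + 1)) ^ 37
        = (24 ^ 10 * 2 ^ 37) * (24 ^ (10 * n) * (2 ^ (n + 1)) ^ 37) := by ring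
      _ < (n + 1) ^ 37 * (n !) ^ 37 :=
        Nat.mul_lt_mul_of_le_of_lt h ih (by positivity)
      _ = ((n + 1) !) ^ 37 := by rw [Nat.factorial_succ, mul_pow]

theorem factorial_le_mul_maxIrrCharDegree_sq {n e : ℕ} (hn : 2 ≤ n)
    (he : (Finset.univ.filter fun p : n.Partition => Even (n + p.parts.card)).card ≤ e) :
    n ! ≤ 4 * e * maxIrrCharDegree (alternatingGroup (Fin n)) ^ 2 := by
  have : Nontrivial (Fin n) := Fin.nontrivial_iff_two_le.2 hn
  have h1 := two_mul_nat_card_alternatingGroup (α := Fin n)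
  rw [Nat.card_perm, Nat.card_fin] at h1
  have h2 := card_conjClasses_alternatingGroup_le (Fin n)
  rw [← h1]
  calc 2 * Nat.card (alternatingGroup (Fin n))
      ≤ 2 * (2 * e * maxIrrCharDegree (alternatingGroup (Fin n)) ^ 2) := by
        refine Nat.mul_le_mul_left 2 (card_le_card_conjClasses_mul_maxIrrCharDegree_sq.trans ?_)
        refine Nat.mul_le_mul_right _ (h2.trans (Nat.mul_le_mul_left 2 ?_))
        convert he <;> simp
    _ = _ := by ring

theorem pow_lt_maxIrrCharDegree_pow {n e : ℕ} (hn : 2 ≤ n)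
    (he : (Finset.univ.filter fun p : n.Partition => Even (n + p.parts.card)).card ≤ e)
    (hlt : 24 ^ (10 * n) * (4 * e) ^ 37 < (n !) ^ 37) :
    24 ^ (5 * n) < maxIrrCharDegree (alternatingGroup (Fin n)) ^ 37 := by
  have h := hlt.trans_le (Nat.pow_le_pow_left (factorial_le_mul_maxIrrCharDegree_sq hn he) 37)
  rw [mul_pow (4 * e), mul_comm ((4 * e) ^ 37)] at h
  have h' := lt_of_mul_lt_mul_right h (Nat.zero_le _)
  apply lt_of_pow_lt_pow_left₀ 2 (Nat.zero_le _)
  calc (24 ^ (5 * n)) ^ 2 = 24 ^ (10 * n) := by rw [← pow_mul]; congr 1; ring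
    _ < _ := h'
    _ = _ := by rw [← pow_mul, ← pow_mul]

theorem card_filter_even_partition_le {n e : ℕ}
    (he : ((boundedParts n n).filter fun s => Even (n + s.card)).length ≤ e) :
    (Finset.univ.filter fun p : n.Partition => Even (n + p.parts.card)).card ≤ e :=
  (card_filter_partition_le n fun s => Even (n + s.card)).trans he

theorem mul_solvableCubeBound_pow_lt {n : ℕ} (hn : 7 ≤ n) :
    (24 * solvableCubeBound n) ^ 5 < maxIrrCharDegree (alternatingGroup (Fin n)) ^ 37 := by
  by_cases h9 : 9 ≤ n
  · have hpow : (24 * solvableCubeBound n) ^ 5 = 24 ^ (5 * n) := by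
      rw [solvableCubeBound_of_nine_le h9, ← Nat.pow_succ', ← pow_mul]
      congr 1
      omega
    rw [hpow]
    by_cases h12 : 12 ≤ n
    · refine pow_lt_maxIrrCharDegree_pow (e := 2 ^ (n - 1)) (by omega)
        ((Finset.card_le_univ _).trans (card_partition_le_two_pow n)) ?_
      convert pow_mul_pow_lt_factorial_pow h12 using 3
      rw [show n + 1 = n - 1 + 2 by omega, pow_add]
      ring
    · have he9 := card_filter_even_partition_le (n := 9) (e := 16) (by decide +kernel)
      have he10 := card_filter_even_partition_le (n := 10) (e := 22) (by decide +kernel)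
      have he11 := card_filter_even_partition_le (n := 11) (e := 29) (by decide +kernel)
      obtain rfl | rfl | rfl : n = 9 ∨ n = 10 ∨ n = 11 := by omega
      · exact pow_lt_maxIrrCharDegree_pow (by norm_num) he9 (by norm_num [Nat.factorial])
      · exact pow_lt_maxIrrCharDegree_pow (by norm_num) he10 (by norm_num [Nat.factorial])
      · exact pow_lt_maxIrrCharDegree_pow (by norm_num) he11 (by norm_num [Nat.factorial])
  · have he7 := card_filter_even_partition_le (n := 7) (e := 8) (by decide +kernel)
    have he8 := card_filter_even_partition_le (n := 8) (e := 12) (by decide +kernel)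
    obtain rfl | rfl : n = 7 ∨ n = 8 := by omega
    · have h := factorial_le_mul_maxIrrCharDegree_sq (by norm_num) he7
      norm_num [Nat.factorial] at h
      have hb : 13 ≤ maxIrrCharDegree (alternatingGroup (Fin 7)) := by nlinarith
      exact lt_of_lt_of_le (by norm_num [solvableCubeBound]) (Nat.pow_le_pow_left hb 37)
    · have h := factorial_le_mul_maxIrrCharDegree_sq (by norm_num) he8
      norm_num [Nat.factorial] at h
      have hb : 29 ≤ maxIrrCharDegree (alternatingGroup (Fin 8)) := by nlinarith
      exact lt_of_lt_of_le (by norm_num [solvableCubeBound]) (Nat.pow_le_pow_left hb 37)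

theorem div_le_three_mul_logb : (37 : ℝ) / 15 ≤ 3 * Real.logb 504 168 := by
  have h : 37 * Real.log 504 ≤ 45 * Real.log 168 := by
    have := Real.log_le_log (by norm_num) (show (504 : ℝ) ^ 37 ≤ 168 ^ 45 by norm_num)
    simpa only [Real.log_pow, Nat.cast_ofNat] using this
  have hpos : 0 < Real.log 504 := Real.log_pos (by norm_num)
  rw [Real.logb, mul_div_assoc', div_le_div_iff₀ (by norm_num) hpos]
  linarith

theorem rpow_mul_lt_rpow_of_pow_lt {s b : ℕ} (h : (24 * s ^ 3) ^ 5 < b ^ 37) :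
    (24 : ℝ) ^ ((1 : ℝ) / 3) * s < (b : ℝ) ^ (3 * Real.logb 504 168) := by
  have hb : (1 : ℝ) ≤ b := by
    rw [Nat.one_le_cast, Nat.one_le_iff_ne_zero]
    rintro rfl
    simp at h
  have hb0 : (0 : ℝ) ≤ b := zero_le_one.trans hb
  refine lt_of_lt_of_le ?_ (Real.rpow_le_rpow_of_exponent_le hb div_le_three_mul_logb)
  apply lt_of_pow_lt_pow_left₀ 15 (by positivity)
  have h1 : ((24 : ℝ) ^ ((1 : ℝ) / 3) * s) ^ 15 = (24 * (s : ℝ) ^ 3) ^ 5 := by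
    have : ((24 : ℝ) ^ ((1 : ℝ) / 3)) ^ 3 = 24 := by
      rw [← Real.rpow_natCast, ← Real.rpow_mul (by norm_num)]
      norm_num
    calc _ = ((((24 : ℝ) ^ ((1 : ℝ) / 3)) ^ 3) * (s : ℝ) ^ 3) ^ 5 := by ring
      _ = _ := by rw [this]
  have h2 : ((b : ℝ) ^ ((37 : ℝ) / 15)) ^ 15 = (b : ℝ) ^ 37 := by
    rw [← Real.rpow_natCast, ← Real.rpow_mul hb0, ← Real.rpow_natCast]
    norm_num
  rw [h1, h2]
  exact_mod_cast h

end Numerics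

/-- For `n ≥ 7`, `λ · S(Aut(Aₙ)) < b(Aₙ) ^ μ`, where `λ = 24^(1/3)` and
`μ = 3·log_{504} 168`. -/
theorem alternating_lambda_solv_aut_lt_maxDeg_rpow_mu (n : ℕ) (hn : 7 ≤ n) :
    (24 : ℝ) ^ ((1 : ℝ) / 3) *
        (maxSolvableOrder (MulAut (alternatingGroup (Fin n))) : ℝ) <
      (maxIrrCharDegree (alternatingGroup (Fin n)) : ℝ) ^ (3 * Real.logb 504 168) := by
  have h := maxSolvableOrder_mulAut_alternatingGroup_cube_le (α := Fin n) (by simpa using hn)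
  rw [Fintype.card_fin] at h
  exact rpow_mul_lt_rpow_of_pow_lt <| lt_of_le_of_lt
    (Nat.pow_le_pow_left (Nat.mul_le_mul_left 24 h) 5) (mul_solvableCubeBound_pow_lt hn)
end

section
/- Let G = PSL_2(8). Then S(Aut(G)) = 168, and for any three pairwise non-Aut-equivalent complex irreducible characters χ₁, χ₂, χ₃ of G one has χ₁(1)·χ₂(1)·χ₃(1) ≤ 504; consequently, μ = 3·log_{504}(168) is the smallest exponent for which the conclusion of Proposition 2.1(a) can hold for G = PSL_2(8). -/
open scoped MatrixGroups

/-- Two irreducible representations of `G` are *Aut-equivalent* if their characters lie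
in the same orbit of the natural action of `Aut G` on irreducible characters. -/
def AutEquivalent {G : Type} [Group G] (V W : FDRep ℂ G) : Prop :=
  ∃ φ : G ≃* G, ∀ g : G, V.character (φ g) = W.character g

/-- `PSL₂(8)`. -/
abbrev PSLTwoEight : Type :=
  Matrix.ProjectiveSpecialLinearGroup (Fin 2) (GaloisField 2 3)

/-- The field with eight elements: `⟨a, b, c⟩` stands for `a + b α + c α²` with `α³ = α + 1`. -/
structure F8 where
  a : Bool
  b : Bool
  c : Bool
  deriving DecidableEq, Fintype

namespace F8

instance : Zero F8 := ⟨⟨false, false, false⟩⟩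
instance : One F8 := ⟨⟨true, false, false⟩⟩
instance : Add F8 := ⟨fun x y => ⟨x.a ^^ y.a, x.b ^^ y.b, x.c ^^ y.c⟩⟩
instance : Neg F8 := ⟨fun x => x⟩
instance : Mul F8 := ⟨fun x y =>
  ⟨(x.a && y.a) ^^ (x.b && y.c) ^^ (x.c && y.b),
   (x.a && y.b) ^^ (x.b && y.a) ^^ (x.b && y.c) ^^ (x.c && y.b) ^^ (x.c && y.c),
   (x.a && y.c) ^^ (x.b && y.b) ^^ (x.c && y.a) ^^ (x.c && y.c)⟩⟩
instance : Inv F8 := ⟨fun x => (x * x) * ((x * x) * (x * x))⟩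

instance : Field F8 where
  add_assoc := by decide +kernel
  zero_add := by decide +kernel
  add_zero := by decide +kernel
  add_comm := by decide +kernel
  left_distrib := by decide +kernel
  right_distrib := by decide +kernel
  zero_mul := by decide +kernel
  mul_zero := by decide +kernel
  mul_assoc := by decide +kernel
  one_mul := by decide +kernel
  mul_one := by decide +kernel
  mul_comm := by decide +kernel
  neg_add_cancel := by decide +kernel
  exists_pair_ne := ⟨0, 1, by decide⟩
  mul_inv_cancel := by decide +kernel
  inv_zero := by decide +kernel
  nsmul := nsmulRec
  zsmul := zsmulRec
  nnqsmul := _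
  nnqsmul_def := fun _ _ => rfl
  qsmul := _
  qsmul_def := fun _ _ => rfl

/-- The generator `α`. -/
def α : F8 := ⟨false, true, false⟩

instance : CharP F8 2 := CharTwo.of_one_ne_zero_of_two_eq_zero one_ne_zero (by decide)

open Matrix

/-- `SL₂` over the field with eight elements. -/
abbrev S : Type := SpecialLinearGroup (Fin 2) F8

/-- The element of `S` with given entries. -/
def ofEntries (a b c d : F8) (h : a * d + b * c = 1) : S :=
  ⟨!![a, b; c, d], by rw [det_fin_two_of, CharTwo.sub_eq_add, h]⟩

lemma ofEntries_mul {a b c d a' b' c' d' : F8} (h : a * d + b * c = 1)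
    (h' : a' * d' + b' * c' = 1) :
    ofEntries a b c d h * ofEntries a' b' c' d' h' =
      ofEntries (a * a' + b * c') (a * b' + b * d') (c * a' + d * c') (c * b' + d * d')
        (by linear_combination (a' * d' + b' * c') * h + h' +
              (a * a' * c * b' + b * c' * d * d') * CharTwo.two_eq_zero (R := F8)) := by
  ext i j
  change (!![a, b; c, d] * !![a', b'; c', d'] : Matrix (Fin 2) (Fin 2) F8) i j = _
  fin_cases i <;> fin_cases j <;> simp [ofEntries]

lemma det_entries (g : S) : g 0 0 * g 1 1 + g 0 1 * g 1 0 = 1 := by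
  have := g.det_coe
  rwa [det_fin_two, CharTwo.sub_eq_add] at this

lemma eq_ofEntries (g : S) : g = ofEntries (g 0 0) (g 0 1) (g 1 0) (g 1 1) (det_entries g) := by
  ext i j; fin_cases i <;> fin_cases j <;> rfl

lemma one_eq_ofEntries : (1 : S) = ofEntries 1 0 0 1 (by decide) := by
  ext i j; fin_cases i <;> fin_cases j <;> rfl

lemma ofEntries_inj {a b c d a' b' c' d' : F8} {h : a * d + b * c = 1}
    {h' : a' * d' + b' * c' = 1} :
    ofEntries a b c d h = ofEntries a' b' c' d' h' ↔ a = a' ∧ b = b' ∧ c = c' ∧ d = d' := by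
  constructor
  · intro e
    have e' := congrArg (fun g : S => (g 0 0, g 0 1, g 1 0, g 1 1)) e
    simpa [ofEntries] using e'
  · rintro ⟨rfl, rfl, rfl, rfl⟩; rfl

/-- Elements of `S` as quadruples of entries. -/
def entriesEquiv : S ≃ {q : F8 × F8 × F8 × F8 // q.1 * q.2.2.2 + q.2.1 * q.2.2.1 = 1} where
  toFun g := ⟨(g 0 0, g 0 1, g 1 0, g 1 1), det_entries g⟩
  invFun q := ofEntries q.1.1 q.1.2.1 q.1.2.2.1 q.1.2.2.2 q.2
  left_inv g := (eq_ofEntries g).symm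
  right_inv _ := rfl

lemma card_S : Nat.card S = 504 := by
  rw [Nat.card_congr entriesEquiv, Nat.card_eq_fintype_card]
  decide +kernel

/-- The trace. -/
def tr (g : S) : F8 := g 0 0 + g 1 1

@[simp] lemma tr_ofEntries {a b c d : F8} (h : a * d + b * c = 1) :
    tr (ofEntries a b c d h) = a + d := rfl

lemma tr_inv (g : S) : tr g⁻¹ = tr g := by
  simp [tr, SpecialLinearGroup.SL2_inv_expl, add_comm]

/-- The companion matrix of `X² + s X + 1`. -/
def comp (s : F8) : S := ofEntries 0 1 1 s (by simp)

/-- A column-cyclic basis change, scaled to determinant one. -/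
def conjugator (a b c d : F8) : F8 × F8 × F8 × F8 :=
  if c ≠ 0 then (c⁻¹ ^ 4, c⁻¹ ^ 4 * a, 0, c⁻¹ ^ 4 * c)
  else if b ≠ 0 then (0, b⁻¹ ^ 4 * b, b⁻¹ ^ 4, b⁻¹ ^ 4 * d)
  else ((a + d)⁻¹ ^ 4, (a + d)⁻¹ ^ 4 * a, (a + d)⁻¹ ^ 4, (a + d)⁻¹ ^ 4 * d)

lemma conjugator_spec : ∀ a b c d : F8, a * d + b * c = 1 →
    ¬ (a = 1 ∧ b = 0 ∧ c = 0 ∧ d = 1) →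
    (conjugator a b c d).1 * (conjugator a b c d).2.2.2 +
      (conjugator a b c d).2.1 * (conjugator a b c d).2.2.1 = 1 ∧
    a * (conjugator a b c d).1 + b * (conjugator a b c d).2.2.1 = (conjugator a b c d).2.1 ∧
    c * (conjugator a b c d).1 + d * (conjugator a b c d).2.2.1 = (conjugator a b c d).2.2.2 ∧
    a * (conjugator a b c d).2.1 + b * (conjugator a b c d).2.2.2 =
      (conjugator a b c d).1 + (conjugator a b c d).2.1 * (a + d) ∧
    c * (conjugator a b c d).2.1 + d * (conjugator a b c d).2.2.2 =
      (conjugator a b c d).2.2.1 + (conjugator a b c d).2.2.2 * (a + d) := by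
  decide +kernel

lemma exists_conj_comp (g : S) (hg : g ≠ 1) : ∃ h : S, g = h * comp (tr g) * h⁻¹ := by
  have hne : ¬ (g 0 0 = 1 ∧ g 0 1 = 0 ∧ g 1 0 = 0 ∧ g 1 1 = 1) := by
    intro h
    apply hg
    rw [eq_ofEntries g, one_eq_ofEntries, ofEntries_inj]
    exact h
  have hg' : ∀ h : S, g * h = ofEntries _ _ _ _ (det_entries g) * h := fun h => by
    rw [← eq_ofEntries]
  have hspec := conjugator_spec _ _ _ _ (det_entries g) hne
  generalize conjugator (g 0 0) (g 0 1) (g 1 0) (g 1 1) = q at hspec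
  obtain ⟨h₀, h₁, h₂, h₃, h₄⟩ := hspec
  refine ⟨ofEntries _ _ _ _ h₀, ?_⟩
  rw [eq_mul_inv_iff_mul_eq, hg', comp, ofEntries_mul, ofEntries_mul, ofEntries_inj]
  simpa [tr] using ⟨h₁, h₃, h₂, h₄⟩

lemma sum_univ {M : Type*} [AddCommMonoid M] (F : F8 → M) :
    ∑ s, F s = F 0 + (F (α ^ 5) + F (α ^ 3) + F (α ^ 6)) +
      (F 1 + F α + F (α ^ 2) + F (α ^ 4)) := by
  rw [show (Finset.univ : Finset F8) =
    {0, α ^ 5, α ^ 3, α ^ 6, 1, α, α ^ 2, α ^ 4} by decide +kernel]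
  repeat rw [Finset.sum_insert (by decide +kernel)]
  rw [Finset.sum_singleton]
  simp only [add_assoc]

lemma card_tr_eq (s : F8) : Fintype.card {g : S // tr g = s} =
    if s = 0 then 64 else if s ∈ [α ^ 5, α ^ 3, α ^ 6] then 72 else 56 := by
  have e : {g : S // tr g = s} ≃ {q : F8 × F8 × F8 × F8 //
      q.1 * q.2.2.2 + q.2.1 * q.2.2.1 = 1 ∧ q.1 + q.2.2.2 = s} :=
    (entriesEquiv.subtypeEquiv (q := fun q => q.1.1 + q.1.2.2.2 = s) fun _ => Iff.rfl).trans
      (Equiv.subtypeSubtypeEquivSubtypeInter _ (fun q : F8 × F8 × F8 × F8 => q.1 + q.2.2.2 = s))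
  rw [Fintype.card_congr e]
  clear e
  revert s
  decide +kernel

set_option linter.constructorNameAsVariable false in
/-- Summing a class function over `S`, where a class function is given by its value at `1` and a
function of the trace. -/
lemma sum_class_function {f : S → ℂ} {F : F8 → ℂ} (hf : ∀ g, g ≠ 1 → f g = F (tr g)) :
    ∑ g, f g = f 1 + 63 * F 0 + 72 * (F (α ^ 5) + F (α ^ 3) + F (α ^ 6)) +
      56 * (F 1 + F α + F (α ^ 2) + F (α ^ 4)) := by
  have h₁ : ∑ g, f g = f 1 - F 0 + ∑ g, F (tr g) := by
    rw [← Finset.add_sum_erase _ _ (Finset.mem_univ (1 : S)),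
      ← Finset.add_sum_erase _ (fun g => F (tr g)) (Finset.mem_univ (1 : S)),
      Finset.sum_congr rfl (fun g hg => hf g (Finset.ne_of_mem_erase hg)),
      show tr 1 = 0 by decide]
    ring
  have h₂ : ∑ g, F (tr g) = ∑ s, (Fintype.card {g : S // tr g = s} : ℂ) * F s := by
    rw [← Finset.sum_fiberwise' Finset.univ tr]
    refine Finset.sum_congr rfl fun s _ => ?_
    rw [Finset.sum_const, nsmul_eq_mul, Fintype.card_subtype]
  rw [h₁, h₂, sum_univ]
  have c₀ : Fintype.card {g : S // tr g = 0} = 64 := by rw [card_tr_eq]; decide +kernel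
  have c₁ : Fintype.card {g : S // tr g = α ^ 5} = 72 := by rw [card_tr_eq]; decide +kernel
  have c₂ : Fintype.card {g : S // tr g = α ^ 3} = 72 := by rw [card_tr_eq]; decide +kernel
  have c₃ : Fintype.card {g : S // tr g = α ^ 6} = 72 := by rw [card_tr_eq]; decide +kernel
  have c₄ : Fintype.card {g : S // tr g = 1} = 56 := by rw [card_tr_eq]; decide +kernel
  have c₅ : Fintype.card {g : S // tr g = α} = 56 := by rw [card_tr_eq]; decide +kernel
  have c₆ : Fintype.card {g : S // tr g = α ^ 2} = 56 := by rw [card_tr_eq]; decide +kernel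
  have c₇ : Fintype.card {g : S // tr g = α ^ 4} = 56 := by rw [card_tr_eq]; decide +kernel
  rw [c₀, c₁, c₂, c₃, c₄, c₅, c₆, c₇]
  push_cast
  ring

end F8

/-- The trace of a complex idempotent is a natural number. -/
lemma exists_trace_eq_natCast {V : Type*} [AddCommGroup V] [Module ℂ V] [FiniteDimensional ℂ V]
    {P : Module.End ℂ V} (hP : IsIdempotentElem P) : ∃ m : ℕ, LinearMap.trace ℂ V P = m :=
  ⟨_, (LinearMap.IsIdempotentElem.isProj_range P hP).trace⟩

/-- The traces of the powers of an endomorphism of finite order are power sums of roots of unity. -/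
lemma exists_trace_pow_eq_sum {V : Type*} [AddCommGroup V] [Module ℂ V] [FiniteDimensional ℂ V]
    {n : ℕ} (hn : n ≠ 0) {A : Module.End ℂ V} (hA : A ^ n = 1) {ω : ℂ} (hω : IsPrimitiveRoot ω n) :
    ∃ m : ℕ → ℕ, ∀ k, LinearMap.trace ℂ V (A ^ k) = ∑ j ∈ Finset.range n, m j * ω ^ (j * k) := by
  have hω0 : ω ≠ 0 := hω.ne_zero hn
  have hn' : (n : ℂ) ≠ 0 := Nat.cast_ne_zero.2 hn
  set P : ℕ → Module.End ℂ V := fun j =>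
    (n : ℂ)⁻¹ • ∑ k ∈ Finset.range n, (ω⁻¹ ^ (j * k)) • A ^ k with hPdef
  have hAP : ∀ j, A * P j = ω ^ j • P j := by
    intro j
    have hshift : ∑ k ∈ Finset.range n, (ω⁻¹ ^ (j * (k + 1))) • A ^ (k + 1) =
        ∑ k ∈ Finset.range n, (ω⁻¹ ^ (j * k)) • A ^ k := by
      let f : ℕ → Module.End ℂ V := fun k => (ω⁻¹ ^ (j * k)) • A ^ k
      have h := (Finset.sum_range_succ' f n).symm.trans (Finset.sum_range_succ f n)
      have h0 : ω ^ (j * n) = 1 := by rw [mul_comm, pow_mul, hω.pow_eq_one, one_pow]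
      simpa [f, h0, hA] using h
    simp only [hPdef]
    rw [mul_smul_comm, smul_comm (ω ^ j)]
    congr 1
    rw [Finset.mul_sum]
    conv_rhs => rw [← hshift, Finset.smul_sum]
    refine Finset.sum_congr rfl fun k _ => ?_
    rw [mul_smul_comm, ← pow_succ', smul_smul]
    congr 1
    rw [mul_add, pow_add, mul_one, mul_left_comm, ← mul_pow, mul_inv_cancel₀ hω0, one_pow, mul_one]
  have hApow : ∀ j k, A ^ k * P j = ω ^ (j * k) • P j := by
    intro j k
    induction k with
    | zero => simp
    | succ k ih => rw [pow_succ, mul_assoc, hAP, mul_smul_comm, ih, smul_smul, mul_add, pow_add,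
        mul_one, mul_comm]
  have hidem : ∀ j, IsIdempotentElem (P j) := by
    intro j
    change P j * P j = P j
    conv_lhs => lhs; rw [hPdef]
    simp only [smul_mul_assoc, Finset.sum_mul, hApow, smul_smul]
    rw [Finset.sum_congr rfl (g := fun _ => P j) (fun k _ => by
      rw [← mul_pow, inv_mul_cancel₀ hω0, one_pow, one_smul])]
    rw [Finset.sum_const, Finset.card_range, ← Nat.cast_smul_eq_nsmul ℂ, smul_smul,
      inv_mul_cancel₀ hn', one_smul]
  have hsum : ∑ j ∈ Finset.range n, P j = 1 := by
    simp only [hPdef]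
    rw [← Finset.smul_sum, Finset.sum_comm]
    simp only [← Finset.sum_smul]
    rw [Finset.sum_eq_single_of_mem 0 (Finset.mem_range.2 (Nat.pos_of_ne_zero hn))]
    · simp [smul_smul, hn', ← Nat.cast_smul_eq_nsmul ℂ]
    · intro k hk hk0
      have hne : ω⁻¹ ^ k - 1 ≠ 0 := sub_ne_zero.2 <|
        hω.inv.pow_ne_one_of_pos_of_lt hk0 (Finset.mem_range.1 hk)
      have h := geom_sum_mul (ω⁻¹ ^ k) n
      rw [← pow_mul, mul_comm k n, pow_mul, hω.inv.pow_eq_one, one_pow, sub_self,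
        mul_eq_zero, or_iff_left hne] at h
      simp only [mul_comm _ k, pow_mul, h, zero_smul]
  choose m hm using fun j => exists_trace_eq_natCast (hidem j)
  refine ⟨m, fun k => ?_⟩
  rw [← mul_one (A ^ k), ← hsum, Finset.mul_sum, map_sum]
  refine Finset.sum_congr rfl fun j _ => ?_
  rw [hApow, map_smul, hm, smul_eq_mul, mul_comm]

namespace Representation

variable {G V : Type*} [Group G] [Finite G] [AddCommGroup V] [Module ℂ V] [FiniteDimensional ℂ V]
  (σ : Representation ℂ G V)

lemma exists_character_pow_eq_sum (g : G) : ∃ ω : ℂ, IsPrimitiveRoot ω (orderOf g) ∧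
    ∃ m : ℕ → ℕ, ∀ k, σ.character (g ^ k) =
      ∑ j ∈ Finset.range (orderOf g), m j * ω ^ (j * k) := by
  have hn : orderOf g ≠ 0 := (orderOf_pos g).ne'
  refine ⟨_, Complex.isPrimitiveRoot_exp _ hn, ?_⟩
  have hA : (σ g) ^ orderOf g = 1 := by rw [← map_pow, pow_orderOf_eq_one, map_one]
  obtain ⟨m, hm⟩ := exists_trace_pow_eq_sum hn hA (Complex.isPrimitiveRoot_exp _ hn)
  exact ⟨m, fun k => by rw [← hm, ← map_pow]; rfl⟩

lemma conj_character (g : G) : (starRingEnd ℂ) (σ.character g) = σ.character g⁻¹ := by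
  obtain ⟨ω, hω, m, hm⟩ := σ.exists_character_pow_eq_sum g
  have hn : orderOf g ≠ 0 := (orderOf_pos g).ne'
  have h₁ := hm 1
  have h₂ := hm (orderOf g - 1)
  rw [pow_one] at h₁
  rw [show g ^ (orderOf g - 1) = g⁻¹ by
    rw [eq_inv_iff_mul_eq_one, ← pow_succ, Nat.sub_add_cancel (orderOf_pos g),
      pow_orderOf_eq_one]] at h₂
  have hconj : (starRingEnd ℂ) ω = ω⁻¹ :=
    (Complex.inv_eq_conj (hω.norm'_eq_one hn)).symm
  have hinv : ω ^ (orderOf g - 1) = ω⁻¹ := by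
    refine eq_inv_of_mul_eq_one_left ?_
    rw [← pow_succ, Nat.sub_add_cancel (orderOf_pos g), hω.pow_eq_one]
  rw [h₁, h₂, map_sum]
  refine Finset.sum_congr rfl fun j _ => ?_
  rw [map_mul, map_pow, map_natCast, hconj, mul_one, mul_comm j, pow_mul, hinv]

lemma isIntegral_character (g : G) : IsIntegral ℤ (σ.character g) := by
  obtain ⟨ω, hω, m, hm⟩ := σ.exists_character_pow_eq_sum g
  have h₁ := hm 1
  rw [pow_one] at h₁
  rw [h₁]
  refine IsIntegral.sum _ fun j _ => ?_
  exact (isIntegral_natCast (R := ℤ) (m j)).mul ((hω.isIntegral (orderOf_pos g)).pow _)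

lemma exists_int_of_character_eq_ratCast {g : G} {q : ℚ} (h : σ.character g = q) :
    ∃ z : ℤ, q = z := by
  have hi := σ.isIntegral_character g
  rw [h, show (q : ℂ) = algebraMap ℚ ℂ q from rfl,
    isIntegral_algebraMap_iff (algebraMap ℚ ℂ).injective] at hi
  obtain ⟨z, hz⟩ := IsIntegrallyClosed.isIntegral_iff.1 hi
  exact ⟨z, by simpa using hz.symm⟩

/-- The twist of a representation by a linear character. -/
def twist (l : G →* ℂ) : Representation ℂ G V where
  toFun g := l g • σ g
  map_one' := by simp
  map_mul' g h := by simp [smul_smul, mul_comm]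

omit [Finite G] [FiniteDimensional ℂ V] in
lemma character_twist (l : G →* ℂ) (g : G) : (σ.twist l).character g = l g * σ.character g := by
  simp [character, twist]

omit [Finite G] in
lemma exists_sum_character_eq [Fintype G] :
    ∃ m : ℕ, ∑ g : G, σ.character g = Nat.card G * m := by
  have hc : (Nat.card G : ℂ) ≠ 0 := Nat.cast_ne_zero.2 Nat.card_pos.ne'
  have := invertibleOfNonzero hc
  refine ⟨Module.finrank ℂ σ.invariants, ?_⟩
  rw [← card_inv_mul_sum_char_eq_finrank, mul_inv_cancel_left₀ hc]

end Representation

namespace F8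

open Matrix

section Borel

/-- The discrete logarithm to base `α`. -/
def log (x : F8) : ℕ := [1, α, α ^ 2, α ^ 3, α ^ 4, α ^ 5, α ^ 6].idxOf x

lemma log_mul : ∀ x y : F8, x ≠ 0 → y ≠ 0 → log (x * y) % 7 = (log x + log y) % 7 := by
  decide +kernel

lemma log_lt : ∀ x : F8, x ≠ 0 → log x < 7 := by decide +kernel

lemma α_pow_log : ∀ x : F8, x ≠ 0 → α ^ log x = x := by decide +kernel

/-- The upper triangular subgroup. -/
def borel : Subgroup S where
  carrier := {g | g 1 0 = 0}
  mul_mem' {g h} hg hh := by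
    change ((g : Matrix (Fin 2) (Fin 2) F8) * (h : Matrix (Fin 2) (Fin 2) F8)) 1 0 = 0
    rw [mul_apply, Fin.sum_univ_two, show g 1 0 = 0 from hg, show h 1 0 = 0 from hh]
    simp
  one_mem' := rfl
  inv_mem' {g} hg := by
    change g 1 0 = 0 at hg
    rw [Set.mem_ofPred_eq, SpecialLinearGroup.SL2_inv_expl]
    change -g 1 0 = 0
    rw [hg, neg_zero]

lemma borel_mul_apply (g h : borel) : (g * h : S) 0 0 = (g : S) 0 0 * (h : S) 0 0 := by
  change (((g : S) : Matrix (Fin 2) (Fin 2) F8) * ((h : S) : Matrix (Fin 2) (Fin 2) F8)) 0 0 = _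
  rw [mul_apply, Fin.sum_univ_two, show (h : S) 1 0 = 0 from h.2]
  simp

lemma borel_apply_ne_zero (g : borel) : (g : S) 0 0 ≠ 0 := by
  intro h
  have h₁ := det_entries (g : S)
  rw [h, show (g : S) 1 0 = 0 from g.2] at h₁
  simp at h₁

/-- The linear character of the Borel subgroup attached to a seventh root of unity. -/
def borelChar {z : ℂ} (hz : z ^ 7 = 1) : borel →* ℂ where
  toFun g := z ^ log ((g : S) 0 0)
  map_one' := by
    rw [show log (((1 : borel) : S) 0 0) = 0 by decide, pow_zero]
  map_mul' g h := by
    rw [← pow_add, pow_eq_pow_mod (log ((g : S) 0 0) + log ((h : S) 0 0)) hz,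
      ← log_mul _ _ (borel_apply_ne_zero g) (borel_apply_ne_zero h), ← pow_eq_pow_mod _ hz,
      ← borel_mul_apply]
    rfl

lemma α_pow_mul : ∀ i : Fin 7, α ^ i.1 * α ^ (6 * i.1) = 1 := by decide +kernel

lemma toBorel_det (p : Fin 7 × F8) : α ^ p.1.1 * α ^ (6 * p.1.1) + p.2 * 0 = 1 := by
  rw [mul_zero, add_zero, α_pow_mul]

/-- The element of the Borel subgroup with diagonal `αⁱ, α⁻ⁱ`. -/
def toBorel (p : Fin 7 × F8) : borel :=
  ⟨ofEntries (α ^ p.1.1) p.2 0 (α ^ (6 * p.1.1)) (toBorel_det p), rfl⟩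

lemma log_α_pow : ∀ i : Fin 7, log (α ^ i.1) = i := by decide +kernel

lemma toBorel_bijective : Function.Bijective toBorel := by
  constructor
  · rintro ⟨i, x⟩ ⟨j, y⟩ h
    obtain ⟨h₁, h₂, -, -⟩ :=
      (ofEntries_inj (h := toBorel_det _) (h' := toBorel_det _)).1 (Subtype.ext_iff.1 h)
    have h₃ := congrArg log h₁
    simp only [log_α_pow] at h₃
    exact Prod.ext (Fin.ext h₃) h₂
  · intro g
    have h₀ := borel_apply_ne_zero g
    refine ⟨⟨⟨log ((g : S) 0 0), log_lt _ h₀⟩, (g : S) 0 1⟩, Subtype.ext ?_⟩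
    have h₁ := α_pow_log _ h₀
    have h₂ := det_entries (g : S)
    rw [show (g : S) 1 0 = 0 from g.2, mul_zero, add_zero] at h₂
    refine ((ofEntries_inj (h := toBorel_det _)).2 ⟨h₁, rfl, g.2.symm, mul_left_cancel₀ h₀
      ?_⟩).trans
      (eq_ofEntries (g : S)).symm
    have h₃ := α_pow_mul ⟨log ((g : S) 0 0), log_lt _ h₀⟩
    rw [h₁] at h₃
    exact h₃.trans h₂.symm

lemma card_borel : Nat.card borel = 56 := by
  rw [← Nat.card_congr (Equiv.ofBijective _ toBorel_bijective), Nat.card_eq_fintype_card]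
  decide +kernel

end Borel

section Characters

variable {V : Type*} [AddCommGroup V] [Module ℂ V] [FiniteDimensional ℂ V]
  (σ : Representation ℂ S V)

/-- The value of the character of `σ` at the noncentral elements of trace `s`. -/
noncomputable def val (s : F8) : ℝ := (σ.character (comp s)).re

lemma conj_character_eq (g : S) : (starRingEnd ℂ) (σ.character g) = σ.character g := by
  rw [σ.conj_character]
  by_cases hg : g = 1
  · rw [hg, inv_one]
  · obtain ⟨h, hh⟩ := exists_conj_comp g hg
    obtain ⟨k, hk⟩ := exists_conj_comp g⁻¹ (inv_ne_one.2 hg)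
    rw [hh, Representation.char_conj, ← hh, hk, Representation.char_conj, tr_inv]

lemma character_comp (s : F8) : σ.character (comp s) = val σ s :=
  (Complex.conj_eq_iff_re.1 (conj_character_eq σ _)).symm

lemma character_eq_val {g : S} (hg : g ≠ 1) : σ.character g = val σ (tr g) := by
  obtain ⟨h, hh⟩ := exists_conj_comp g hg
  conv_lhs => rw [hh, Representation.char_conj]
  rw [character_comp]

lemma character_inv (g : S) : σ.character g⁻¹ = σ.character g := by
  rw [← σ.conj_character, conj_character_eq]

lemma exists_invariants :
    ∃ m : ℕ, (Module.finrank ℂ V : ℝ) + 63 * val σ 0 +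
      72 * (val σ (α ^ 5) + val σ (α ^ 3) + val σ (α ^ 6)) +
      56 * (val σ 1 + val σ α + val σ (α ^ 2) + val σ (α ^ 4)) = 504 * m := by
  obtain ⟨m, hm⟩ := σ.exists_sum_character_eq
  refine ⟨m, ?_⟩
  rw [sum_class_function (F := fun s => (val σ s : ℂ)) (fun g hg => character_eq_val σ hg),
    card_S, Representation.char_one] at hm
  exact_mod_cast hm

lemma norm_eq (h : ∑ g, σ.character g * σ.character g⁻¹ = Nat.card S) :
    (Module.finrank ℂ V : ℝ) ^ 2 + 63 * val σ 0 ^ 2 +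
      72 * (val σ (α ^ 5) ^ 2 + val σ (α ^ 3) ^ 2 + val σ (α ^ 6) ^ 2) +
      56 * (val σ 1 ^ 2 + val σ α ^ 2 + val σ (α ^ 2) ^ 2 + val σ (α ^ 4) ^ 2) = 504 := by
  simp only [character_inv, ← pow_two] at h
  rw [sum_class_function (F := fun s => (val σ s : ℂ) ^ 2)
    (fun g hg => by rw [character_eq_val σ hg]), card_S, Representation.char_one] at h
  exact_mod_cast h

lemma exists_borel_sum {z : ℂ} (hz : z ^ 7 = 1) :
    ∃ m : ℕ, (Module.finrank ℂ V : ℂ) + 7 * val σ 0 + 8 * ((z + z ^ 6) * val σ (α ^ 5) +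
      (z ^ 2 + z ^ 5) * val σ (α ^ 3) + (z ^ 3 + z ^ 4) * val σ (α ^ 6)) = 56 * m := by
  have := Fintype.ofFinite borel
  obtain ⟨m, hm⟩ := Representation.exists_sum_character_eq
    (Representation.twist (σ.comp borel.subtype) (borelChar hz))
  refine ⟨m, ?_⟩
  rw [card_borel] at hm
  rw [← Nat.cast_ofNat (R := ℂ) (n := 56), ← hm]
  simp only [Representation.character_twist]
  rw [← (Equiv.ofBijective _ toBorel_bijective).sum_comp, Fintype.sum_prod_type]
  have key : ∀ i : Fin 7, i ≠ 0 → ∀ x : F8, σ.character (toBorel (i, x)) =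
      val σ (α ^ i.1 + α ^ (6 * i.1)) := by
    intro i hi x
    rw [character_eq_val]
    · rfl
    · intro h
      have h₁ := congrArg log ((ofEntries_inj (h := toBorel_det _)).1 (h.trans one_eq_ofEntries)).1
      rw [log_α_pow] at h₁
      exact hi (Fin.ext (h₁.trans (by decide)))
  have key₀ : ∑ x : F8, σ.character (toBorel (0, x)) = Module.finrank ℂ V + 7 * val σ 0 := by
    have h₁ : ∀ x : F8, x ≠ 0 → σ.character (toBorel (0, x)) = val σ 0 := by
      intro x hx
      rw [character_eq_val]
      · rfl
      · intro h
        exact hx ((ofEntries_inj (h := toBorel_det _)).1 (h.trans one_eq_ofEntries)).2.1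
    rw [← Finset.add_sum_erase _ _ (Finset.mem_univ (0 : F8)),
      Finset.sum_congr rfl (fun x hx => h₁ x (Finset.ne_of_mem_erase hx)), Finset.sum_const,
      show (Finset.univ.erase (0 : F8)).card = 7 by decide +kernel,
      show ((toBorel (0, 0) : borel) : S) = 1 by decide +kernel, Representation.char_one]
    simp
  have hterm : ∀ i : Fin 7, ∑ x : F8, borelChar hz (toBorel (i, x)) *
      Representation.character (σ.comp borel.subtype) (toBorel (i, x)) =
      z ^ i.1 * ∑ x : F8, σ.character (toBorel (i, x)) := by
    intro i
    rw [Finset.mul_sum]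
    refine Finset.sum_congr rfl fun x _ => ?_
    congr 1
    change z ^ log (α ^ i.1) = _
    rw [log_α_pow]
  simp only [Equiv.ofBijective_apply, hterm]
  rw [Fin.sum_univ_succ, key₀]
  simp only [Fin.sum_univ_six, key _ (Fin.succ_ne_zero _), Finset.sum_const]
  rw [show (Finset.univ : Finset F8).card = 8 by decide +kernel]
  have e : ∀ i : Fin 7, i ≠ 0 → α ^ i.1 + α ^ (6 * i.1) = 
    [0, α ^ 5, α ^ 3, α ^ 6, α ^ 6, α ^ 3, α ^ 5].get i := by decide +kernel
  simp only [e _ (Fin.succ_ne_zero _)]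
  simp
  ring

end Characters

section SeventhRoots

/-- A primitive seventh root of unity. -/
noncomputable def ζ : ℂ := Complex.exp (2 * Real.pi * Complex.I / (7 : ℕ))

lemma isPrimitiveRoot_ζ : IsPrimitiveRoot ζ 7 := Complex.isPrimitiveRoot_exp 7 (by norm_num)

/-- The real numbers `ζᵏ + ζ⁻ᵏ`. -/
noncomputable def κ (k : ℕ) : ℝ := 2 * (ζ ^ k).re

lemma ζ_pow_mod (n : ℕ) : ζ ^ n = ζ ^ (n % 7) := pow_eq_pow_mod n isPrimitiveRoot_ζ.pow_eq_one

lemma κ_eq (k : ℕ) : (κ k : ℂ) = ζ ^ k + ζ ^ (6 * k) := by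
  have h₁ : (starRingEnd ℂ) (ζ ^ k) = (ζ ^ k)⁻¹ :=
    (Complex.inv_eq_conj (by
      rw [norm_pow, isPrimitiveRoot_ζ.norm'_eq_one (by norm_num), one_pow])).symm
  have h₂ : (ζ ^ k)⁻¹ = ζ ^ (6 * k) := by
    refine inv_eq_of_mul_eq_one_right ?_
    rw [← pow_add, show k + 6 * k = 7 * k by ring, pow_mul, isPrimitiveRoot_ζ.pow_eq_one, one_pow]
  rw [κ, ← h₂, ← h₁, Complex.add_conj]

lemma κ_one : (κ 1 : ℂ) = ζ + ζ ^ 6 := by rw [κ_eq, pow_one]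

lemma κ_two : (κ 2 : ℂ) = ζ ^ 2 + ζ ^ 5 := by rw [κ_eq, ζ_pow_mod (6 * 2)]

lemma κ_three : (κ 3 : ℂ) = ζ ^ 3 + ζ ^ 4 := by rw [κ_eq, ζ_pow_mod (6 * 3)]

lemma κ_add : κ 1 + κ 2 + κ 3 = -1 := by
  have h := isPrimitiveRoot_ζ.geom_sum_eq_zero (by norm_num)
  simp only [Finset.sum_range_succ, Finset.sum_range_zero] at h
  have : (κ 1 : ℂ) + κ 2 + κ 3 = -1 := by
    rw [κ_one, κ_two, κ_three]
    linear_combination h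
  exact_mod_cast this

lemma κ_mul_κ : κ 1 * κ 1 = κ 2 + 2 ∧ κ 2 * κ 2 = κ 3 + 2 ∧ κ 3 * κ 3 = κ 1 + 2 ∧
    κ 1 * κ 2 = κ 1 + κ 3 ∧ κ 1 * κ 3 = κ 2 + κ 3 ∧ κ 2 * κ 3 = κ 1 + κ 2 := by
  have h := isPrimitiveRoot_ζ.pow_eq_one
  rw [← sub_eq_zero] at h
  have h₁ : (κ 1 : ℂ) * κ 1 = κ 2 + 2 := by
    rw [κ_one, κ_two]; linear_combination (2 + ζ ^ 5) * h
  have h₂ : (κ 2 : ℂ) * κ 2 = κ 3 + 2 := by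
    rw [κ_two, κ_three]; linear_combination (2 + ζ ^ 3) * h
  have h₃ : (κ 3 : ℂ) * κ 3 = κ 1 + 2 := by
    rw [κ_three, κ_one]; linear_combination (2 + ζ) * h
  have h₄ : (κ 1 : ℂ) * κ 2 = κ 1 + κ 3 := by
    rw [κ_two, κ_three, κ_one]; linear_combination (ζ + ζ ^ 4) * h
  have h₅ : (κ 1 : ℂ) * κ 3 = κ 2 + κ 3 := by
    rw [κ_two, κ_three, κ_one]; linear_combination (ζ ^ 2 + ζ ^ 3) * h
  have h₆ : (κ 2 : ℂ) * κ 3 = κ 1 + κ 2 := by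
    rw [κ_two, κ_three, κ_one]; linear_combination (ζ + ζ ^ 2) * h
  exact ⟨by exact_mod_cast h₁, by exact_mod_cast h₂, by exact_mod_cast h₃, by exact_mod_cast h₄,
    by exact_mod_cast h₅, by exact_mod_cast h₆⟩

end SeventhRoots

section Arithmetic

/-- A weighted sum of squares with the weights of the conjugacy classes of `S` that is at most
zero has all terms zero. -/
lemma eq_zero_of_weighted_sq_le {d v a b c x y z t : ℝ}
    (h : d ^ 2 + 63 * v ^ 2 + 72 * (a ^ 2 + b ^ 2 + c ^ 2) +
      56 * (x ^ 2 + y ^ 2 + z ^ 2 + t ^ 2) ≤ 0) :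
    d = 0 ∧ v = 0 ∧ a = 0 ∧ b = 0 ∧ c = 0 ∧ x = 0 ∧ y = 0 ∧ z = 0 ∧ t = 0 := by
  have key : ∀ u : ℝ, u ^ 2 ≤ 0 → u = 0 := fun u hu =>
    pow_eq_zero_iff two_ne_zero |>.1 (le_antisymm hu (sq_nonneg u))
  have := sq_nonneg d
  have := sq_nonneg v
  have := sq_nonneg a
  have := sq_nonneg b
  have := sq_nonneg c
  have := sq_nonneg x
  have := sq_nonneg y
  have := sq_nonneg z
  have := sq_nonneg t
  refine ⟨?_, ?_, ?_, ?_, ?_, ?_, ?_, ?_, ?_⟩ <;> apply key <;> linarith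

/-- If the inner product with the character of degree nine that is attached to `ζ` does not vanish,
then the characters agree. -/
lemma eq_of_one_le_principal {d v a b c x y z t p q r : ℝ} (hp : p * p = q + 2)
    (hq : q * q = r + 2) (hr : r * r = p + 2) (hs : p + q + r = -1)
    (hn : d ^ 2 + 63 * v ^ 2 + 72 * (a ^ 2 + b ^ 2 + c ^ 2) +
      56 * (x ^ 2 + y ^ 2 + z ^ 2 + t ^ 2) = 504)
    {n : ℕ} (h : d + 7 * v + 8 * (p * a + q * b + r * c) = 56 * n) (h₁ : 1 ≤ n) :
    d = 9 ∧ v = 1 ∧ a = p ∧ b = q ∧ c = r ∧ x = 0 ∧ y = 0 ∧ z = 0 ∧ t = 0 := by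
  have h₁' : (1 : ℝ) ≤ n := by exact_mod_cast h₁
  have := eq_zero_of_weighted_sq_le (d := d - 9) (v := v - 1) (a := a - p) (b := b - q)
    (c := c - r) (x := x) (y := y) (z := z) (t := t) (by nlinarith)
  simpa only [sub_eq_zero] using this

/-- The possible values of the irreducible characters of `S`. -/
lemma classification {v a b c x y z t p q r : ℝ} {d : ℕ} (hp : p * p = q + 2)
    (hq : q * q = r + 2) (hr : r * r = p + 2) (hpq : p * q = p + r) (hpr : p * r = q + r)
    (hqr : q * r = p + q) (hs : p + q + r = -1)
    (hn : (d : ℝ) ^ 2 + 63 * v ^ 2 + 72 * (a ^ 2 + b ^ 2 + c ^ 2) +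
      56 * (x ^ 2 + y ^ 2 + z ^ 2 + t ^ 2) = 504)
    (ht : ∃ n : ℕ, d + 63 * v + 72 * (a + b + c) + 56 * (x + y + z + t) = 504 * n)
    (h₀ : ∃ n : ℕ, d + 7 * v + 8 * (2 * a + 2 * b + 2 * c) = 56 * n)
    (h₁ : ∃ n : ℕ, d + 7 * v + 8 * (p * a + q * b + r * c) = 56 * n)
    (h₂ : ∃ n : ℕ, d + 7 * v + 8 * (q * a + r * b + p * c) = 56 * n)
    (h₃ : ∃ n : ℕ, d + 7 * v + 8 * (r * a + p * b + q * c) = 56 * n)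
    (hv : ∀ k : ℚ, v = k → ∃ m : ℤ, k = m) (hx : ∀ k : ℚ, x = k → ∃ m : ℤ, k = m) :
    d ≤ 7 ∨
    (d = 8 ∧ v = 0 ∧ a = 1 ∧ b = 1 ∧ c = 1 ∧ x = -1 ∧ y = -1 ∧ z = -1 ∧ t = -1) ∨
    (d = 9 ∧ v = 1 ∧ ((a = p ∧ b = q ∧ c = r) ∨ (a = q ∧ b = r ∧ c = p) ∨
      (a = r ∧ b = p ∧ c = q)) ∧ x = 0 ∧ y = 0 ∧ z = 0 ∧ t = 0) := by
  obtain ⟨m, hm⟩ := ht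
  obtain ⟨n₀, h₀⟩ := h₀
  obtain ⟨n₁, h₁⟩ := h₁
  obtain ⟨n₂, h₂⟩ := h₂
  obtain ⟨n₃, h₃⟩ := h₃
  by_cases hn₁ : 1 ≤ n₁
  · obtain ⟨e₁, e₂, e₃, e₄, e₅, e₆⟩ := eq_of_one_le_principal hp hq hr hs hn h₁ hn₁
    exact .inr (.inr ⟨by exact_mod_cast e₁, e₂, .inl ⟨e₃, e₄, e₅⟩, e₆⟩)
  by_cases hn₂ : 1 ≤ n₂
  · obtain ⟨e₁, e₂, e₃, e₄, e₅, e₆⟩ :=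
      eq_of_one_le_principal hq hr hp (by linarith) hn h₂ hn₂
    exact .inr (.inr ⟨by exact_mod_cast e₁, e₂, .inr (.inl ⟨e₃, e₄, e₅⟩), e₆⟩)
  by_cases hn₃ : 1 ≤ n₃
  · obtain ⟨e₁, e₂, e₃, e₄, e₅, e₆⟩ :=
      eq_of_one_le_principal hr hp hq (by linarith) hn h₃ hn₃
    exact .inr (.inr ⟨by exact_mod_cast e₁, e₂, .inr (.inr ⟨e₃, e₄, e₅⟩), e₆⟩)
  by_cases hm₁ : 1 ≤ m
  · have hm₁' : (1 : ℝ) ≤ m := by exact_mod_cast hm₁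
    have e := (eq_zero_of_weighted_sq_le (d := d - 1) (v := v - 1) (a := a - 1) (b := b - 1)
      (c := c - 1) (x := x - 1) (y := y - 1) (z := z - 1) (t := t - 1) (by linarith)).1
    have : d = 1 := by exact_mod_cast sub_eq_zero.1 e
    omega
  obtain rfl : n₁ = 0 := by omega
  obtain rfl : n₂ = 0 := by omega
  obtain rfl : n₃ = 0 := by omega
  obtain rfl : m = 0 := by omega
  rw [Nat.cast_zero, mul_zero] at h₁ h₂ h₃ hm
  by_cases hn₀ : 1 ≤ n₀
  · have hn₀' : (1 : ℝ) ≤ n₀ := by exact_mod_cast hn₀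
    obtain ⟨e₁, e₂, e₃, e₄, e₅, e₆, e₇, e₈, e₉⟩ := eq_zero_of_weighted_sq_le (d := d - 8) (v := v)
      (a := a - 1) (b := b - 1) (c := c - 1) (x := x + 1) (y := y + 1) (z := z + 1) (t := t + 1)
      (by linarith)
    have : d = 8 := by exact_mod_cast sub_eq_zero.1 e₁
    exact .inr (.inl ⟨this, e₂, by linarith, by linarith, by linarith, by linarith, by linarith,
      by linarith, by linarith⟩)
  left
  obtain rfl : n₀ = 0 := by omega
  rw [Nat.cast_zero, mul_zero] at h₀
  have s₀ : (d : ℝ) + 7 * v = 0 ∧ a + b + c = 0 := by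
    have := congrArg (· * (a + b + c)) hs
    constructor <;> linarith
  obtain ⟨s₁, s₂⟩ := s₀
  have l₁ : p * a + q * b + r * c = 0 := by linarith
  have l₂ : q * a + r * b + p * c = 0 := by linarith
  have l₃ : r * a + p * b + q * c = 0 := by linarith
  have ha : a = 0 := by
    linear_combination (1 / 7) * (p * l₁ + q * l₂ + r * l₃ + 2 * s₂ - a * (hp + hq + hr + hs)
      - (b + c) * (hpq + hpr + hqr + 2 * hs))
  have hb : b = 0 := by
    linear_combination (1 / 7) * (q * l₁ + r * l₂ + p * l₃ + 2 * s₂ - b * (hp + hq + hr + hs)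
      - (a + c) * (hpq + hpr + hqr + 2 * hs))
  have hc : c = 0 := by linarith
  subst ha hb hc
  have hv' : v = -d / 7 := by linarith
  have hd : (d : ℝ) ^ 2 ≤ 14 ^ 2 := by
    subst hv'
    have e : (d : ℝ) = 7 * (x + y + z + t) := by linarith
    have : (x + y + z + t) ^ 2 ≤ 4 * (x ^ 2 + y ^ 2 + z ^ 2 + t ^ 2) := by
      nlinarith [sq_nonneg (x - y), sq_nonneg (x - z), sq_nonneg (x - t), sq_nonneg (y - z),
        sq_nonneg (y - t), sq_nonneg (z - t)]
    nlinarith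
  have hd' : d ≤ 14 := by
    have := abs_le_of_sq_le_sq' hd (by norm_num)
    exact_mod_cast this.2
  obtain ⟨k, hk⟩ := hv (-d / 7) (by rw [hv']; push_cast; ring)
  have hk' : (d : ℤ) = -7 * k := by
    have : (d : ℚ) = -7 * k := by linarith
    exact_mod_cast this
  rcases Nat.lt_or_ge 7 d with h7 | h7
  · exfalso
    obtain rfl : d = 14 := by omega
    push_cast at *
    have e₁ : (x - 1 / 2) ^ 2 = 0 := by
      obtain rfl : v = -2 := by linarith
      nlinarith [sq_nonneg (x - 1 / 2), sq_nonneg (y - 1 / 2), sq_nonneg (z - 1 / 2),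
        sq_nonneg (t - 1 / 2)]
    have e₂ : x = 1 / 2 := sub_eq_zero.1 (pow_eq_zero_iff two_ne_zero |>.1 e₁)
    obtain ⟨j, hj⟩ := hx (1 / 2) (by rw [e₂]; norm_num)
    have : (1 : ℚ) = 2 * j := by linarith
    have : (1 : ℤ) = 2 * j := by exact_mod_cast this
    omega
  · exact h7

end Arithmetic

section Frobenius

/-- The Frobenius automorphism of `S`. -/
noncomputable def frob : MulAut S :=
  MulEquiv.ofBijective (SpecialLinearGroup.map (frobenius F8 2)) <| Finite.injective_iff_bijective.1
    fun g h e => by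
      ext i j
      have e' := congrArg (fun k : S => k i j) e
      exact frobenius_inj F8 2 e'

lemma frob_apply (g : S) (i j : Fin 2) : frob g i j = g i j ^ 2 := rfl

lemma tr_frob (g : S) : tr (frob g) = tr g ^ 2 := (CharTwo.add_sq (g 0 0) (g 1 1)).symm

lemma tr_frob_pow (k : ℕ) (g : S) : tr ((frob ^ k) g) = tr g ^ 2 ^ k := by
  induction k generalizing g with
  | zero => simp
  | succ k ih =>
    rw [pow_succ, MulAut.mul_apply, ih, tr_frob, ← pow_mul, pow_succ']

end Frobenius

section Classification

variable {V : Type*} [AddCommGroup V] [Module ℂ V] [FiniteDimensional ℂ V]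
  {W : Type*} [AddCommGroup W] [Module ℂ W] [FiniteDimensional ℂ W]
  (σ : Representation ℂ S V) (τ : Representation ℂ S W)

/-- The values of the Steinberg character. -/
def steinberg (s : F8) : ℝ := if s = 0 then 0 else if s ∈ [α ^ 5, α ^ 3, α ^ 6] then 1 else -1

/-- The values of a character in the principal series. -/
noncomputable def principal (s : F8) : ℝ :=
  if s = 0 then 1 else if s = α ^ 5 then κ 1 else if s = α ^ 3 then κ 2 else
    if s = α ^ 6 then κ 3 else 0

lemma α_pow_mod (n : ℕ) : α ^ n = α ^ (n % 7) := pow_eq_pow_mod n (by decide)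

lemma forall_iff {P : F8 → Prop} : (∀ s, P s) ↔ P 0 ∧ P (α ^ 5) ∧ P (α ^ 3) ∧ P (α ^ 6) ∧
    P 1 ∧ P α ∧ P (α ^ 2) ∧ P (α ^ 4) := by
  refine ⟨fun h => ⟨h _, h _, h _, h _, h _, h _, h _, h _⟩,
    fun ⟨h₁, h₂, h₃, h₄, h₅, h₆, h₇, h₈⟩ s => ?_⟩
  have : ∀ s : F8, s = 0 ∨ s = α ^ 5 ∨ s = α ^ 3 ∨ s = α ^ 6 ∨ s = 1 ∨ s = α ∨ s = α ^ 2 ∨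
    s = α ^ 4 := by decide +kernel
  rcases this s with rfl | rfl | rfl | rfl | rfl | rfl | rfl | rfl <;> assumption

lemma steinberg_values : steinberg 0 = 0 ∧ steinberg (α ^ 5) = 1 ∧ steinberg (α ^ 3) = 1 ∧
    steinberg (α ^ 6) = 1 ∧ steinberg 1 = -1 ∧ steinberg α = -1 ∧ steinberg (α ^ 2) = -1 ∧
    steinberg (α ^ 4) = -1 := by
  have h : ∀ s : F8, s ≠ 0 → s ∉ [α ^ 5, α ^ 3, α ^ 6] → steinberg s = -1 := fun s h₁ h₂ => by
    rw [steinberg, if_neg h₁, if_neg h₂]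
  have h' : ∀ s : F8, s ≠ 0 → s ∈ [α ^ 5, α ^ 3, α ^ 6] → steinberg s = 1 := fun s h₁ h₂ => by
    rw [steinberg, if_neg h₁, if_pos h₂]
  exact ⟨if_pos rfl, h' _ (by decide) (by decide), h' _ (by decide) (by decide),
    h' _ (by decide) (by decide), h _ (by decide) (by decide), h _ (by decide) (by decide),
    h _ (by decide) (by decide), h _ (by decide) (by decide)⟩

lemma principal_values : principal 0 = 1 ∧ principal (α ^ 5) = κ 1 ∧ principal (α ^ 3) = κ 2 ∧
    principal (α ^ 6) = κ 3 ∧ principal 1 = 0 ∧ principal α = 0 ∧ principal (α ^ 2) = 0 ∧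
    principal (α ^ 4) = 0 := by
  have h : ∀ s : F8, s ≠ 0 → s ≠ α ^ 5 → s ≠ α ^ 3 → s ≠ α ^ 6 → principal s = 0 :=
    fun s h₁ h₂ h₃ h₄ => by rw [principal, if_neg h₁, if_neg h₂, if_neg h₃, if_neg h₄]
  refine ⟨if_pos rfl, ?_, ?_, ?_, h _ (by decide) (by decide) (by decide) (by decide),
    h _ (by decide) (by decide) (by decide) (by decide),
    h _ (by decide) (by decide) (by decide) (by decide),
    h _ (by decide) (by decide) (by decide) (by decide)⟩
  · rw [principal, if_neg (by decide), if_pos rfl]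
  · rw [principal, if_neg (by decide), if_neg (by decide), if_pos rfl]
  · rw [principal, if_neg (by decide), if_neg (by decide), if_neg (by decide), if_pos rfl]

/-- The character values in the cases of degree eight and nine. -/
lemma val_classification (h : ∑ g, σ.character g * σ.character g⁻¹ = Nat.card S) :
    Module.finrank ℂ V ≤ 7 ∨ (Module.finrank ℂ V = 8 ∧ ∀ s, val σ s = steinberg s) ∨
      (Module.finrank ℂ V = 9 ∧ ∃ k : ℕ, ∀ s, val σ (s ^ 2 ^ k) = principal s) := by
  obtain ⟨h₁, h₂, h₃, h₄, h₅, h₆⟩ := κ_mul_κ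
  have hζ := isPrimitiveRoot_ζ.pow_eq_one
  have hint : ∀ (s : F8) (k : ℚ), val σ s = k → ∃ m : ℤ, k = m := fun s k hk =>
    σ.exists_int_of_character_eq_ratCast (g := comp s)
      (by rw [character_comp, hk, Complex.ofReal_ratCast])
  have hb : ∀ (z : ℂ) (p q r : ℝ), z ^ 7 = 1 → z + z ^ 6 = p → z ^ 2 + z ^ 5 = q →
      z ^ 3 + z ^ 4 = r → ∃ n : ℕ, (Module.finrank ℂ V : ℝ) + 7 * val σ 0 +
        8 * (p * val σ (α ^ 5) + q * val σ (α ^ 3) + r * val σ (α ^ 6)) = 56 * n := by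
    intro z p q r hz hp hq hr
    obtain ⟨n, hn⟩ := exists_borel_sum σ hz
    rw [hp, hq, hr] at hn
    exact ⟨n, by exact_mod_cast hn⟩
  have key := classification h₁ h₂ h₃ h₄ h₅ h₆ κ_add (norm_eq σ h) (exists_invariants σ)
    (hb 1 2 2 2 (by norm_num) (by norm_num) (by norm_num) (by norm_num))
    (hb ζ _ _ _ hζ κ_one.symm κ_two.symm κ_three.symm)
    (hb (ζ ^ 2) _ _ _ (by rw [← pow_mul, mul_comm, pow_mul, hζ, one_pow])
      (by rw [κ_two, ← pow_mul, ζ_pow_mod (2 * 6)])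
      (by rw [κ_three, ← pow_mul, ← pow_mul, ζ_pow_mod (2 * 5), add_comm])
      (by rw [κ_one, ← pow_mul, ← pow_mul, ζ_pow_mod (2 * 4), add_comm, pow_one]))
    (hb (ζ ^ 3) _ _ _ (by rw [← pow_mul, mul_comm, pow_mul, hζ, one_pow])
      (by rw [κ_three, ← pow_mul, ζ_pow_mod (3 * 6)])
      (by rw [κ_one, ← pow_mul, ← pow_mul, ζ_pow_mod (3 * 5), add_comm, pow_one])
      (by rw [κ_two, ← pow_mul, ← pow_mul, ζ_pow_mod (3 * 3), ζ_pow_mod (3 * 4)]))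
    (hint 0) (hint 1)
  refine key.imp_right (Or.imp (And.imp_right ?_) (And.imp_right ?_))
  · rw [forall_iff]
    obtain ⟨e₁, e₂, e₃, e₄, e₅, e₆, e₇, e₈⟩ := steinberg_values
    rw [e₁, e₂, e₃, e₄, e₅, e₆, e₇, e₈]
    exact id
  · simp only [forall_iff]
    obtain ⟨e₁, e₂, e₃, e₄, e₅, e₆, e₇, e₈⟩ := principal_values
    rw [e₁, e₂, e₃, e₄, e₅, e₆, e₇, e₈]
    rintro ⟨k₁, hk, k₅, k₆, k₇, k₈⟩
    rcases hk with ⟨k₂, k₃, k₄⟩ | ⟨k₂, k₃, k₄⟩ | ⟨k₂, k₃, k₄⟩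
    · exact ⟨0, by simp [*]⟩
    · refine ⟨2, ?_⟩
      simp only [← pow_mul]
      rw [α_pow_mod (5 * 2 ^ 2), α_pow_mod (3 * 2 ^ 2), α_pow_mod (6 * 2 ^ 2),
        α_pow_mod (2 * 2 ^ 2), α_pow_mod (4 * 2 ^ 2)]
      norm_num [*]
    · refine ⟨1, ?_⟩
      simp only [← pow_mul]
      rw [α_pow_mod (5 * 2 ^ 1), α_pow_mod (3 * 2 ^ 1), α_pow_mod (6 * 2 ^ 1),
        α_pow_mod (4 * 2 ^ 1)]
      norm_num [*]

/-- Two irreducible characters of the same degree at least eight are conjugate under the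
automorphism group. -/
lemma exists_mulEquiv_of_finrank_eq (hσ : ∑ g, σ.character g * σ.character g⁻¹ = Nat.card S)
    (hτ : ∑ g, τ.character g * τ.character g⁻¹ = Nat.card S)
    (h : Module.finrank ℂ V = Module.finrank ℂ W) (h₇ : 7 < Module.finrank ℂ V) :
    ∃ φ : MulAut S, ∀ g, σ.character (φ g) = τ.character g := by
  have key : ∀ j k : ℕ, (∀ s, val σ (s ^ 2 ^ j) = val τ (s ^ 2 ^ k)) →
      ∃ φ : MulAut S, ∀ g, σ.character (φ g) = τ.character g := by
    intro j k hjk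
    refine ⟨frob ^ j * (frob ^ k)⁻¹, fun g => ?_⟩
    obtain ⟨g, rfl⟩ := (frob ^ k).surjective g
    rw [MulAut.mul_apply, MulAut.inv_apply_self]
    by_cases hg : g = 1
    · simp [hg, h]
    · rw [character_eq_val σ (by simpa using hg), character_eq_val τ (by simpa using hg),
        tr_frob_pow, tr_frob_pow, hjk]
  rcases val_classification σ hσ with h₁ | ⟨h₁, h₂⟩ | ⟨h₁, j, h₂⟩
  · omega
  · rcases val_classification τ hτ with h₃ | ⟨h₃, h₄⟩ | ⟨h₃, -⟩
    · omega
    · exact key 0 0 fun s => by rw [h₂, h₄]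
    · omega
  · rcases val_classification τ hτ with h₃ | ⟨h₃, -⟩ | ⟨h₃, k, h₄⟩
    · omega
    · omega
    · exact key j k fun s => by rw [h₂, h₄]

lemma finrank_le_nine (hσ : ∑ g, σ.character g * σ.character g⁻¹ = Nat.card S) :
    Module.finrank ℂ V ≤ 9 := by
  rcases val_classification σ hσ with h | ⟨h, -⟩ | ⟨h, -⟩ <;> omega

end Classification

section Transport

lemma center_eq_bot : Subgroup.center (SpecialLinearGroup (Fin 2) (GaloisField 2 3)) = ⊥ := by
  refine (Subgroup.eq_bot_iff_forall _).2 fun g hg => ?_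
  obtain ⟨r, hr, h⟩ := Matrix.SpecialLinearGroup.mem_center_iff.1 hg
  rw [Fintype.card_fin] at hr
  have hr' : r = 1 := by
    have h₁ : (r + 1) ^ 2 = 0 := by rw [CharTwo.add_sq, hr, one_pow, CharTwo.add_self_eq_zero]
    exact (CharTwo.add_eq_zero).1 (pow_eq_zero_iff two_ne_zero |>.1 h₁)
  ext1
  rw [← h, hr', map_one]
  rfl

/-- The field `F8` is the Galois field with eight elements. -/
noncomputable def galoisFieldEquiv : GaloisField 2 3 ≃+* F8 :=
  letI := Fintype.ofFinite (GaloisField 2 3)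
  FiniteField.ringEquivOfCardEq <| by
    rw [← Nat.card_eq_fintype_card, GaloisField.card 2 3 (by norm_num)]
    decide +kernel

/-- The special linear groups over the two models of the field with eight elements agree. -/
noncomputable def specialLinearEquiv : SpecialLinearGroup (Fin 2) (GaloisField 2 3) ≃* S where
  toFun := SpecialLinearGroup.map galoisFieldEquiv
  invFun := SpecialLinearGroup.map galoisFieldEquiv.symm
  left_inv g := by
    ext i j
    exact galoisFieldEquiv.symm_apply_apply (g i j)
  right_inv g := by
    ext i j
    exact galoisFieldEquiv.apply_symm_apply (g i j)
  map_mul' := map_mul _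

/-- The isomorphism of `PSL₂(8)` with `S`. -/
noncomputable def pslEquiv : PSLTwoEight ≃* S :=
  (QuotientGroup.quotientMulEquivOfEq center_eq_bot).trans
    (QuotientGroup.quotientBot.trans specialLinearEquiv)

instance isSimpleGroup_S : IsSimpleGroup S := by
  have : IsSimpleGroup PSLTwoEight := ProjectiveSpecialLinearGroup.rank_two_simple <| by
    rw [GaloisField.card 2 3 (by norm_num)]
    norm_num
  exact pslEquiv.symm.isSimpleGroup

/-- The representation of `S` attached to a representation of `PSL₂(8)`. -/
noncomputable def transport (V : FDRep ℂ PSLTwoEight) : Representation ℂ S V :=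
  V.ρ.comp pslEquiv.symm.toMonoidHom

lemma character_transport (V : FDRep ℂ PSLTwoEight) (g : S) :
    (transport V).character g = V.character (pslEquiv.symm g) := rfl

lemma sum_character_transport (V : FDRep ℂ PSLTwoEight) (hV : CategoryTheory.Simple V) :
    ∑ g, (transport V).character g * (transport V).character g⁻¹ = Nat.card S := by
  have := Fintype.ofFinite PSLTwoEight
  have h := FDRep.char_orthonormal V V
  rw [if_pos ⟨CategoryTheory.Iso.refl _⟩,
    inv_mul_eq_one₀ (Nat.cast_ne_zero.2 Nat.card_pos.ne')] at h
  rw [← Nat.card_congr pslEquiv.toEquiv, h, ← pslEquiv.symm.toEquiv.sum_comp]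
  exact Finset.sum_congr rfl fun g _ => by
    rw [character_transport, character_transport, map_inv]; rfl

lemma finrank_le (V : FDRep ℂ PSLTwoEight) (hV : CategoryTheory.Simple V) :
    Module.finrank ℂ V ≤ 9 :=
  finrank_le_nine (transport V) (sum_character_transport V hV)

lemma autEquivalent_of_finrank_eq (V W : FDRep ℂ PSLTwoEight) (hV : CategoryTheory.Simple V)
    (hW : CategoryTheory.Simple W) (h : Module.finrank ℂ V = Module.finrank ℂ W)
    (h₇ : 7 < Module.finrank ℂ V) : AutEquivalent V W := by
  obtain ⟨φ, hφ⟩ := exists_mulEquiv_of_finrank_eq (transport V) (transport W)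
    (sum_character_transport V hV) (sum_character_transport W hW) h h₇
  refine ⟨(MulAut.congr pslEquiv).symm φ, fun g => ?_⟩
  have := hφ (pslEquiv g)
  rw [character_transport, character_transport, MulEquiv.symm_apply_apply] at this
  exact this

lemma finrank_mul_le (V₁ V₂ V₃ : FDRep ℂ PSLTwoEight) (h₁ : CategoryTheory.Simple V₁)
    (h₂ : CategoryTheory.Simple V₂) (h₃ : CategoryTheory.Simple V₃) (h₁₂ : ¬ AutEquivalent V₁ V₂)
    (h₁₃ : ¬ AutEquivalent V₁ V₃) (h₂₃ : ¬ AutEquivalent V₂ V₃) :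
    Module.finrank ℂ V₁ * Module.finrank ℂ V₂ * Module.finrank ℂ V₃ ≤ 504 := by
  have key : ∀ a b c : Fin 10, (a.1 = b.1 → ¬ 7 < a.1) → (a.1 = c.1 → ¬ 7 < a.1) →
      (b.1 = c.1 → ¬ 7 < b.1) → a.1 * b.1 * c.1 ≤ 504 := by decide +kernel
  exact key ⟨_, Nat.lt_succ_of_le (finrank_le V₁ h₁)⟩ ⟨_, Nat.lt_succ_of_le (finrank_le V₂ h₂)⟩
    ⟨_, Nat.lt_succ_of_le (finrank_le V₃ h₃)⟩
    (fun e h => h₁₂ (autEquivalent_of_finrank_eq V₁ V₂ h₁ h₂ e h))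
    (fun e h => h₁₃ (autEquivalent_of_finrank_eq V₁ V₃ h₁ h₃ e h))
    (fun e h => h₂₃ (autEquivalent_of_finrank_eq V₂ V₃ h₂ h₃ e h))

end Transport

end F8

lemma SemidirectProduct.isSolvable {N G : Type*} [Group N] [Group G] (φ : G →* MulAut N)
    [Group.IsSolvable N] [Group.IsSolvable G] : Group.IsSolvable (N ⋊[φ] G) :=
  Group.isSolvable_of_ker_le_range inl rightHom range_inl_eq_ker_rightHom.ge

namespace F8

open Matrix

section Solvable

/-- The upper unitriangular element with entry `x`. -/
def unip (x : F8) : S := ofEntries 1 x 0 1 (by simp)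

lemma unip_mul (x y : F8) : unip x * unip y = unip (x + y) := by
  rw [unip, unip, ofEntries_mul, unip, ofEntries_inj]
  simp [add_comm]

/-- The diagonal entry of an upper triangular element. -/
def borelDiag : borel →* F8ˣ where
  toFun g := Units.mk0 _ (borel_apply_ne_zero g)
  map_one' := Units.ext rfl
  map_mul' g h := Units.ext (borel_mul_apply g h)

lemma isSolvable_borel : Group.IsSolvable borel := by
  have h : ∀ g : borelDiag.ker, ∃ x, (g : S) = unip x := by
    rintro ⟨g, hg⟩
    have h₀ : (g : S) 0 0 = 1 := congrArg Units.val hg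
    have h₁ : (g : S) 1 0 = 0 := g.2
    have h₂ := det_entries (g : S)
    rw [h₀, h₁, one_mul, mul_zero, add_zero] at h₂
    exact ⟨(g : S) 0 1, (eq_ofEntries (g : S)).trans (ofEntries_inj.2 ⟨h₀, rfl, h₁, h₂⟩)⟩
  have : Group.IsSolvable borelDiag.ker := Group.isSolvable_of_comm fun g k => by
    obtain ⟨x, hx⟩ := h g
    obtain ⟨y, hy⟩ := h k
    refine Subtype.ext (Subtype.ext ?_)
    change (g : S) * k = k * g
    rw [hx, hy, unip_mul, unip_mul, add_comm]
  exact Group.isSolvable_of_ker_le_range borelDiag.ker.subtype borelDiag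
    (Subgroup.range_subtype _).ge

lemma frob_pow_three : frob ^ 3 = 1 := by
  have h : ∀ x : F8, ((x ^ 2) ^ 2) ^ 2 = x := by decide
  ext g i j
  exact h (g i j)

lemma frob_ne_one : frob ≠ 1 := by
  intro h
  have h₁ := congrArg (fun φ : MulAut S => tr (φ (comp α))) h
  simp only [tr_frob, MulAut.one_apply] at h₁
  exact absurd h₁ (by decide)

lemma card_zpowers_frob : Nat.card (Subgroup.zpowers frob) = 3 := by
  rw [Nat.card_zpowers]
  exact orderOf_eq_prime frob_pow_three frob_ne_one

lemma frob_comp_zero : frob (comp 0) = comp 0 := by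
  ext i j
  rw [frob_apply]
  fin_cases i <;> fin_cases j <;> rfl

/-- The inner automorphisms given by the upper triangular subgroup. -/
def innerBorel : Subgroup (MulAut S) := borel.map MulAut.conj

lemma zpowers_frob_le_normalizer : Subgroup.zpowers frob ≤ Subgroup.normalizer innerBorel := by
  have key : ∀ φ ∈ innerBorel, frob * φ * frob⁻¹ ∈ innerBorel := by
    rintro - ⟨b, hb, rfl⟩
    refine ⟨frob b, ?_, ?_⟩
    · change b 1 0 ^ 2 = 0
      rw [show b 1 0 = 0 from hb, zero_pow two_ne_zero]
    · ext1 g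
      simp
  rw [Subgroup.zpowers_le, Subgroup.mem_normalizer_iff]
  refine fun φ => ⟨key φ, fun h => ?_⟩
  have h₁ := key _ (key _ h)
  have h₂ : frob * (frob * (frob * φ * frob⁻¹) * frob⁻¹) * frob⁻¹ =
      frob ^ 3 * φ * (frob ^ 3)⁻¹ := by
    simp only [pow_succ, pow_zero, one_mul, _root_.mul_inv_rev, mul_assoc]
  rwa [h₂, frob_pow_three, one_mul, inv_one, mul_one] at h₁

lemma eq_one_of_commute_comp_zero {b : S} (hb : b ∈ borel) (h : b * comp 0 = comp 0 * b) :
    b = 1 := by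
  obtain ⟨p, q, r, s, hd, rfl⟩ : ∃ p q r s, ∃ hd : p * s + q * r = 1, b = ofEntries p q r s hd :=
    ⟨_, _, _, _, _, eq_ofEntries b⟩
  have hr : r = 0 := hb
  subst hr
  rw [comp, ofEntries_mul, ofEntries_mul, ofEntries_inj] at h
  rw [one_eq_ofEntries, ofEntries_inj]
  have h₁ : ∀ p : F8, p * p = 1 → p = 1 := by decide
  simp only [mul_zero, mul_one, zero_add, add_zero, zero_mul, one_mul] at h hd
  obtain ⟨h₂, h₃, -⟩ := h
  subst h₂ h₃
  rw [mul_zero, add_zero] at hd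
  exact ⟨h₁ _ hd, rfl, rfl, h₁ _ hd⟩

lemma conj_injective : Function.Injective (MulAut.conj : S →* MulAut S) := by
  rw [injective_iff_map_eq_one]
  intro g hg
  have h : ∀ k, g * k = k * g := fun k => by
    rw [← mul_inv_eq_iff_eq_mul, ← MulAut.conj_apply, hg, MulAut.one_apply]
  refine eq_one_of_commute_comp_zero ?_ (h _)
  have h₁ := h (unip 1)
  obtain ⟨p, q, r, s, hd, rfl⟩ : ∃ p q r s, ∃ hd : p * s + q * r = 1, g = ofEntries p q r s hd :=
    ⟨_, _, _, _, _, eq_ofEntries g⟩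
  rw [unip, ofEntries_mul, ofEntries_mul, ofEntries_inj] at h₁
  change r = 0
  simpa using h₁.1

lemma exists_isSolvable_card_eq :
    ∃ H : Subgroup (MulAut S), Group.IsSolvable H ∧ Nat.card H = 168 := by
  have := isSolvable_borel
  have : Group.IsSolvable innerBorel :=
    Group.isSolvable_of_surjective (MulAut.conj.subgroupMap_surjective borel)
  have : Group.IsSolvable (Subgroup.zpowers frob) := Group.isSolvable_of_comm fun a b =>
    Subtype.ext (setLike_mul_comm a.2 b.2)
  have hcard : Nat.card innerBorel = 56 := by
    rw [← card_borel]
    exact (Nat.card_congr (borel.equivMapOfInjective _ conj_injective).toEquiv).symm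
  let f := SemidirectProduct.monoidHomSubgroup zpowers_frob_le_normalizer
  have hf : Function.Injective f := by
    rw [injective_iff_map_eq_one]
    rintro ⟨⟨-, b, hb, rfl⟩, ψ, hψ⟩ h
    change MulAut.conj b * ψ = 1 at h
    have hψ₀ : ψ (comp 0) = comp 0 :=
      (Subgroup.zpowers_le (H := MulAction.stabilizer (MulAut S) (comp 0))).2 frob_comp_zero hψ
    have h₀ := congrArg (fun φ : MulAut S => φ (comp 0)) h
    simp only [MulAut.mul_apply, hψ₀, MulAut.conj_apply, MulAut.one_apply,
      mul_inv_eq_iff_eq_mul] at h₀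
    obtain rfl := eq_one_of_commute_comp_zero hb h₀
    rw [map_one, one_mul] at h
    subst h
    exact SemidirectProduct.ext (Subtype.ext (map_one _)) rfl
  have := SemidirectProduct.isSolvable
    (innerBorel.normalizerMonoidHom.comp (Subgroup.inclusion zpowers_frob_le_normalizer))
  refine ⟨f.range, Group.isSolvable_of_surjective f.rangeRestrict_surjective, ?_⟩
  rw [← Nat.card_congr (MonoidHom.ofInjective hf).toEquiv, SemidirectProduct.card, hcard,
    card_zpowers_frob]

end Solvable

section Automorphisms

/-- An element of `S` of order three. -/
def orderThree : S := ofEntries 0 α (α ^ 6) 1 (by decide)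

lemma mul_unip : ∀ x, comp 0 * orderThree * unip x = unip (α ^ 5 * x) * (comp 0 * orderThree) := by
  decide +kernel

lemma eq_top_of_mem {H : Subgroup S} (ha : comp 0 ∈ H) (hb : orderThree ∈ H) : H = ⊤ := by
  have hu : ∀ k : ℕ, unip (α ^ (4 + 5 * k)) ∈ H := by
    intro k
    induction k with
    | zero =>
      have h : unip (α ^ (4 + 5 * 0)) = orderThree * comp 0 * orderThree * comp 0 *
          (orderThree * orderThree) * comp 0 * (orderThree * orderThree) := by decide +kernel
      rw [h]
      exact H.mul_mem (H.mul_mem (H.mul_mem (H.mul_mem (H.mul_mem (H.mul_mem hb ha) hb) ha)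
        (H.mul_mem hb hb)) ha) (H.mul_mem hb hb)
    | succ k ih =>
      have h := eq_mul_inv_of_mul_eq (mul_unip (α ^ (4 + 5 * k))).symm
      rw [← pow_add, show 5 + (4 + 5 * k) = 4 + 5 * (k + 1) by ring] at h
      rw [h]
      exact H.mul_mem (H.mul_mem (H.mul_mem ha hb) ih) (H.inv_mem (H.mul_mem ha hb))
  have hx : ∀ x : F8, x = 0 ∨ ∃ k : Fin 7, x = α ^ (4 + 5 * k.1) := by decide +kernel
  have hunip : ∀ x, unip x ∈ H := by
    intro x
    obtain rfl | ⟨k, rfl⟩ := hx x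
    · exact (show unip 0 = 1 by decide) ▸ H.one_mem
    · exact hu k
  have hne : ∀ (a b c d : F8) (h : a * d + b * c = 1), c ≠ 0 → ofEntries a b c d h ∈ H := by
    intro a b c d h hc
    have key : ofEntries a b c d h = unip ((1 + a) * c⁻¹) * (comp 0 * unip c * comp 0) *
        unip ((1 + d) * c⁻¹) := by
      revert a b c d
      decide +kernel
    rw [key]
    exact H.mul_mem (H.mul_mem (hunip _) (H.mul_mem (H.mul_mem ha (hunip _)) ha)) (hunip _)
  refine (Subgroup.eq_top_iff' H).2 fun g => ?_
  obtain ⟨a, b, c, d, h, rfl⟩ : ∃ a b c d, ∃ h : a * d + b * c = 1, g = ofEntries a b c d h :=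
    ⟨_, _, _, _, _, eq_ofEntries g⟩
  by_cases hc : c = 0
  · subst hc
    rw [← H.mul_mem_cancel_left ha, comp, ofEntries_mul]
    refine hne _ _ _ _ _ ?_
    intro h₀
    simp only [one_mul, mul_zero, add_zero] at h h₀
    rw [h₀, zero_mul] at h
    exact zero_ne_one h
  · exact hne _ _ _ _ _ hc

lemma comp_tr_pow_eq_one {g : S} (hg : g ≠ 1) {n : ℕ} (h : g ^ n = 1) : comp (tr g) ^ n = 1 := by
  obtain ⟨k, hk⟩ := exists_conj_comp g hg
  rw [hk, conj_pow] at h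
  exact conj_eq_one_iff.1 h

lemma tr_eq_zero_of_sq : ∀ t, comp t ^ 2 = 1 → t = 0 := by decide +kernel

lemma tr_eq_one_of_cube : ∀ t, comp t ^ 3 = 1 → t = 1 := by decide +kernel

lemma tr_mem_of_pow_seven : ∀ t, comp t ^ 7 = 1 → t = α ^ 3 ∨ t = α ^ 5 ∨ t = α ^ 6 := by
  decide +kernel

/-- Matrices of order two, up to their last entry. -/
def involutions : Finset (F8 × F8 × F8) :=
  {p | p.1 * p.1 + p.2.1 * p.2.2 = 1 ∧ p ≠ (1, 0, 0)}

/-- Matrices of order three, up to their last entry. -/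
def cubeRoots : Finset (F8 × F8 × F8) :=
  {p | p.1 * (p.1 + 1) + p.2.1 * p.2.2 = 1}

/-- Pairs of an involution and an element of order three whose product has order seven. -/
@[irreducible]
def hurwitzPairs : Finset ((F8 × F8 × F8) × F8 × F8 × F8) :=
  {p ∈ involutions ×ˢ cubeRoots | p.1.1 + p.1.2.1 * p.2.2.2 + p.1.2.2 * p.2.2.1 ∈
    [α ^ 3, α ^ 5, α ^ 6]}

lemma mem_hurwitzPairs_iff {a b : F8 × F8 × F8} : (a, b) ∈ hurwitzPairs ↔
    a.1 * a.1 + a.2.1 * a.2.2 = 1 ∧ a ≠ (1, 0, 0) ∧ b.1 * (b.1 + 1) + b.2.1 * b.2.2 = 1 ∧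
      a.1 + a.2.1 * b.2.2 + a.2.2 * b.2.1 ∈ [α ^ 3, α ^ 5, α ^ 6] := by
  unfold hurwitzPairs
  rw [Finset.mem_filter, Finset.mem_product, involutions, cubeRoots,
    Finset.mem_filter_univ, Finset.mem_filter_univ, and_assoc, and_assoc]

lemma card_hurwitzPairs : hurwitzPairs.card = 1512 := by decide +kernel

/-- The entries of a matrix except the last one. -/
def firstEntries (g : S) : F8 × F8 × F8 := (g 0 0, g 0 1, g 1 0)

lemma eq_of_firstEntries_eq {g h : S} (e : firstEntries g = firstEntries h) (ht : tr g = tr h) :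
    g = h := by
  obtain ⟨p, q, r, s, hd, rfl⟩ : ∃ p q r s, ∃ hd : p * s + q * r = 1, g = ofEntries p q r s hd :=
    ⟨_, _, _, _, _, eq_ofEntries g⟩
  obtain ⟨p', q', r', s', hd', rfl⟩ :
      ∃ p q r s, ∃ hd : p * s + q * r = 1, h = ofEntries p q r s hd :=
    ⟨_, _, _, _, _, eq_ofEntries h⟩
  simp only [firstEntries, Prod.mk.injEq] at e
  obtain ⟨h₁, h₂, h₃⟩ := e
  change p = p' at h₁
  subst h₁
  exact ofEntries_inj.2 ⟨rfl, h₂, h₃, add_left_cancel ht⟩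

lemma tr_apply_comp_zero (φ : MulAut S) : φ (comp 0) ≠ 1 ∧ tr (φ (comp 0)) = 0 := by
  have h : φ (comp 0) ≠ 1 := (map_ne_one_iff _ φ.injective).2 (by decide)
  refine ⟨h, tr_eq_zero_of_sq _ (comp_tr_pow_eq_one h ?_)⟩
  rw [← map_pow, show comp 0 ^ 2 = 1 by decide +kernel, map_one]

lemma tr_apply_orderThree (φ : MulAut S) : tr (φ orderThree) = 1 := by
  have h : φ orderThree ≠ 1 := (map_ne_one_iff _ φ.injective).2 (by decide)
  refine tr_eq_one_of_cube _ (comp_tr_pow_eq_one h ?_)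
  rw [← map_pow, show orderThree ^ 3 = 1 by decide +kernel, map_one]

lemma tr_apply_mul (φ : MulAut S) :
    tr (φ (comp 0) * φ orderThree) ∈ [α ^ 3, α ^ 5, α ^ 6] := by
  rw [← map_mul]
  have h : φ (comp 0 * orderThree) ≠ 1 := (map_ne_one_iff _ φ.injective).2 (by decide)
  have h₁ := tr_mem_of_pow_seven _ (comp_tr_pow_eq_one h (n := 7) (by
    rw [← map_pow, show (comp 0 * orderThree) ^ 7 = 1 by decide +kernel, map_one]))
  simpa using h₁

lemma mem_hurwitzPairs (φ : MulAut S) :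
    (firstEntries (φ (comp 0)), firstEntries (φ orderThree)) ∈ hurwitzPairs := by
  obtain ⟨h₁, h₂⟩ := tr_apply_comp_zero φ
  have h₃ := tr_apply_orderThree φ
  have h₄ := tr_apply_mul φ
  generalize φ (comp 0) = g at h₁ h₂ h₄ ⊢
  generalize φ orderThree = h at h₃ h₄ ⊢
  obtain ⟨p, q, r, s, hd, rfl⟩ : ∃ p q r s, ∃ hd : p * s + q * r = 1, g = ofEntries p q r s hd :=
    ⟨_, _, _, _, _, eq_ofEntries g⟩
  obtain ⟨x, y, z, w, hd', rfl⟩ :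
      ∃ p q r s, ∃ hd : p * s + q * r = 1, h = ofEntries p q r s hd :=
    ⟨_, _, _, _, _, eq_ofEntries h⟩
  rw [ofEntries_mul] at h₄
  rw [tr_ofEntries] at h₂ h₃ h₄
  obtain rfl := CharTwo.add_eq_zero.1 h₂
  have hw : w = x + 1 := by rw [← h₃, ← add_assoc, CharTwo.add_self_eq_zero, zero_add]
  subst hw
  have h₅ : p * x + q * z + (r * y + p * (x + 1)) = p + q * z + r * y := by
    linear_combination (p * x) * CharTwo.two_eq_zero (R := F8)
  rw [h₅] at h₄
  refine mem_hurwitzPairs_iff.2 ⟨hd, fun h => h₁ ?_, hd', h₄⟩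
  simp only [Prod.mk.injEq, firstEntries] at h
  rw [one_eq_ofEntries, ofEntries_inj]
  exact ⟨h.1, h.2.1, h.2.2, h.1⟩

lemma firstEntries_injective : Function.Injective
    (fun φ : MulAut S => (firstEntries (φ (comp 0)), firstEntries (φ orderThree))) := by
  intro φ ψ h
  obtain ⟨h₁, h₂⟩ := Prod.mk.inj h
  have h₃ := eq_of_firstEntries_eq h₁
    ((tr_apply_comp_zero φ).2.trans (tr_apply_comp_zero ψ).2.symm)
  have h₄ := eq_of_firstEntries_eq h₂
    ((tr_apply_orderThree φ).trans (tr_apply_orderThree ψ).symm)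
  have h₅ := eq_top_of_mem (H := φ.toMonoidHom.eqLocus ψ.toMonoidHom) h₃ h₄
  exact MulEquiv.ext fun g => (h₅ ▸ Subgroup.mem_top g : g ∈ φ.toMonoidHom.eqLocus ψ.toMonoidHom)

instance : Finite (MulAut S) := Finite.of_injective _ firstEntries_injective

lemma card_mulAut_le : Nat.card (MulAut S) ≤ 1512 := by
  have := Fintype.ofFinite (MulAut S)
  rw [Nat.card_eq_fintype_card, ← card_hurwitzPairs]
  exact Finset.card_le_card_of_injOn _ (fun φ _ => mem_hurwitzPairs φ)
    firstEntries_injective.injOn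

end Automorphisms

lemma card_le_of_isSolvable (H : Subgroup (MulAut S)) (hH : Group.IsSolvable H) :
    Nat.card H ≤ 168 := by
  by_contra! hlt
  have hindex : H.index ≤ 8 := by
    by_contra! h
    have h₁ := Nat.mul_le_mul hlt h
    rw [Subgroup.card_mul_index] at h₁
    exact absurd (h₁.trans card_mulAut_le) (by decide)
  set x : MulAut S := MulAut.conj (comp α) with hx
  have hx₉ : x ^ 9 = 1 := by
    rw [hx, ← map_pow, show comp α ^ 9 = 1 by decide +kernel, map_one]
  have hfix : ∀ c : MulAut S ⧸ H, x ^ 3 • c = c := by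
    intro c
    have h₁ : Function.minimalPeriod (x • ·) c ∣ 3 ^ 2 := by
      refine Function.IsPeriodicPt.minimalPeriod_dvd ?_
      change (x • ·)^[9] c = c
      rw [smul_iterate, hx₉]
      exact one_smul _ c
    have := Fintype.ofFinite (MulAut S ⧸ H)
    have h₂ : Function.minimalPeriod (x • ·) c ≤ 8 :=
      (Function.minimalPeriod_le_card (f := (x • ·)) (x := c)).trans
        (by rwa [← Nat.card_eq_fintype_card])
    obtain ⟨k, hk, h₃⟩ := (Nat.dvd_prime_pow Nat.prime_three).1 h₁
    have h₄ : Function.minimalPeriod (x • ·) c ∣ 3 := by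
      interval_cases k <;> simp_all
    have h₅ := (Function.isPeriodicPt_minimalPeriod (x • ·) c).trans_dvd h₄
    change (x • ·)^[3] c = c at h₅
    rwa [smul_iterate] at h₅
  have hcore : x ^ 3 ∈ H.normalCore := by
    rw [Subgroup.normalCore_eq_ker, MonoidHom.mem_ker]
    exact Equiv.ext hfix
  have htop : H.normalCore.comap (MulAut.conj : S →* MulAut S) = ⊤ := by
    refine (Subgroup.Normal.eq_bot_or_eq_top inferInstance).resolve_left fun h => ?_
    have h₁ : comp α ^ 3 ∈ H.normalCore.comap (MulAut.conj : S →* MulAut S) := by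
      rw [Subgroup.mem_comap, map_pow]
      exact hcore
    rw [h, Subgroup.mem_bot] at h₁
    exact absurd h₁ (by decide +kernel)
  have hmem : ∀ g : S, MulAut.conj g ∈ H := fun g =>
    H.normalCore_le (htop ▸ Subgroup.mem_top g :
      g ∈ H.normalCore.comap (MulAut.conj : S →* MulAut S))
  have hS : Group.IsSolvable S :=
    Group.isSolvable_of_isSolvable_injective (f := (MulAut.conj : S →* MulAut S).codRestrict H hmem)
      fun a b h => conj_injective (congrArg Subtype.val h)
  exact absurd (IsSimpleGroup.comm_iff_isSolvable.2 hS (comp 0) (unip 1)) (by decide +kernel)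

end F8

lemma exists_isSolvable_of_mulEquiv {G K : Type*} [Group G] [Group K] (e : G ≃* K) {n : ℕ}
    (h : ∃ H : Subgroup G, Group.IsSolvable H ∧ Nat.card H = n) :
    ∃ H : Subgroup K, Group.IsSolvable H ∧ Nat.card H = n := by
  obtain ⟨H, hH, rfl⟩ := h
  exact ⟨H.map e.toMonoidHom,
    Group.isSolvable_of_surjective (e.toMonoidHom.subgroupMap_surjective H),
    (Nat.card_congr (H.equivMapOfInjective _ e.injective).toEquiv).symm⟩

lemma maxSolvableOrder_congr {G K : Type*} [Group G] [Group K] (e : G ≃* K) :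
    maxSolvableOrder G = maxSolvableOrder K :=
  congrArg sSup <| Set.ext fun _ =>
    ⟨exists_isSolvable_of_mulEquiv e, exists_isSolvable_of_mulEquiv e.symm⟩

namespace F8

lemma maxSolvableOrder_mulAut : maxSolvableOrder (MulAut PSLTwoEight) = 168 := by
  rw [maxSolvableOrder_congr (MulAut.congr pslEquiv)]
  refine IsGreatest.csSup_eq ⟨exists_isSolvable_card_eq, ?_⟩
  rintro n ⟨H, hH, rfl⟩
  exact card_le_of_isSolvable H hH

end F8

lemma three_mul_logb_le {b c : ℝ} {P : ℕ} {ν : ℝ} (hb : 1 < b) (hc : 1 < c) (hP : (P : ℝ) ≤ b)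
    (h : c ≤ (P : ℝ) ^ (ν / 3)) : 3 * Real.logb b c ≤ ν := by
  have hP₀ : 1 ≤ (P : ℝ) := by
    rw [Nat.one_le_cast, Nat.one_le_iff_ne_zero]
    rintro rfl
    rw [Nat.cast_zero] at h
    exact (hc.trans_le h).not_ge (Real.zero_rpow_le_one _)
  have hν : 0 ≤ ν / 3 := by
    by_contra! hν
    exact (hc.trans_le h).not_ge (Real.rpow_le_one_of_one_le_of_nonpos hP₀ hν.le)
  have h₁ : Real.logb b c ≤ ν / 3 := by
    rw [Real.logb_le_iff_le_rpow hb (by linarith)]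
    exact h.trans (Real.rpow_le_rpow (by linarith) hP hν)
  linarith

/-- For `G = PSL₂(8)`: `S(Aut G) = 168`; any three pairwise non-Aut-equivalent irreducible
characters `χ₁, χ₂, χ₃` of `G` satisfy `χ₁(1)·χ₂(1)·χ₃(1) ≤ 504`; consequently
`μ = 3·log_{504} 168` is the smallest exponent `ν` for which the conclusion of
Proposition 2.1(a), `S(Aut G) ≤ (χ₁(1)·χ₂(1)·χ₃(1)) ^ (ν/3)` for some pairwise
non-Aut-equivalent irreducible `χᵢ`, can hold for `G = PSL₂(8)`. -/
theorem pslTwoEight_mu_optimal :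
    maxSolvableOrder (MulAut PSLTwoEight) = 168 ∧
    (∀ V₁ V₂ V₃ : FDRep ℂ PSLTwoEight,
      CategoryTheory.Simple V₁ → CategoryTheory.Simple V₂ → CategoryTheory.Simple V₃ →
      ¬ AutEquivalent V₁ V₂ → ¬ AutEquivalent V₁ V₃ → ¬ AutEquivalent V₂ V₃ →
      Module.finrank ℂ V₁ * Module.finrank ℂ V₂ * Module.finrank ℂ V₃ ≤ 504) ∧
    (∀ ν : ℝ,
      (∃ V₁ V₂ V₃ : FDRep ℂ PSLTwoEight,
        CategoryTheory.Simple V₁ ∧ CategoryTheory.Simple V₂ ∧ CategoryTheory.Simple V₃ ∧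
        ¬ AutEquivalent V₁ V₂ ∧ ¬ AutEquivalent V₁ V₃ ∧ ¬ AutEquivalent V₂ V₃ ∧
        (maxSolvableOrder (MulAut PSLTwoEight) : ℝ) ≤
          ((Module.finrank ℂ V₁ * Module.finrank ℂ V₂ * Module.finrank ℂ V₃ : ℕ) : ℝ) ^
            (ν / 3)) →
      3 * Real.logb 504 168 ≤ ν) := by
  refine ⟨F8.maxSolvableOrder_mulAut, F8.finrank_mul_le, ?_⟩
  rintro ν ⟨V₁, V₂, V₃, h₁, h₂, h₃, h₁₂, h₁₃, h₂₃, h⟩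
  rw [F8.maxSolvableOrder_mulAut] at h
  exact three_mul_logb_le (by norm_num) (by norm_num)
    (by exact_mod_cast F8.finrank_mul_le V₁ V₂ V₃ h₁ h₂ h₃ h₁₂ h₁₃ h₂₃) (by exact_mod_cast h)
end
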